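/- arXiv:2309.11237 — 3 statements merged into one kernel-verified Lean document; each statement's English description precedes it below -/
import Mathlib

section
/- There exist constants c₁, c₂ > 0 such that for all integers k ≥ 3, c₁/√k ≤ π − 2 d_GH(S^2, S^k) ≤ c₂/√k. -/
open Real

noncomputable section

/-- Euclidean space ℝ^d. -/
abbrev Euc (d : ℕ) : Type := EuclideanSpace ℝ (Fin d)

/-- The unit sphere S^n = {x ∈ ℝ^{n+1} : ⟨x,x⟩ = 1}. -/
def usphere (n : ℕ) : Set (Euc (n+1)) := {x | @inner ℝ _ _ x x = (1:ℝ)}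

/-- The geodesic distance d(x,y) = arccos⟨x,y⟩. -/
def geoDist {d : ℕ} (x y : Euc d) : ℝ := Real.arccos (@inner ℝ _ _ x y)

/-- A correspondence between A ⊆ ℝ^{d₁} and B ⊆ ℝ^{d₂}: a relation R ⊆ A × B whose
coordinate projections to A and B are both surjective. -/
def IsCorrespondence {d₁ d₂ : ℕ} (A : Set (Euc d₁)) (B : Set (Euc d₂))
    (R : Set (Euc d₁ × Euc d₂)) : Prop :=
  (∀ z ∈ R, z.1 ∈ A ∧ z.2 ∈ B) ∧
  (∀ a ∈ A, ∃ b ∈ B, (a, b) ∈ R) ∧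
  (∀ b ∈ B, ∃ a ∈ A, (a, b) ∈ R)

/-- The distortion of a relation, with respect to the geodesic metrics:
dis(R) = sup |d(x,x') − d(y,y')| over (x,y), (x',y') ∈ R. -/
def distortion {d₁ d₂ : ℕ} (R : Set (Euc d₁ × Euc d₂)) : ℝ :=
  sSup {t | ∃ z ∈ R, ∃ w ∈ R, t = |geoDist z.1 w.1 - geoDist z.2 w.2|}

/-- Twice the Gromov–Hausdorff distance between S^n and S^k (geodesic metrics),
via the Kalton–Ostrovskii formula: the infimum of dis(R) over all correspondences R. -/
def twoGH (n k : ℕ) : ℝ :=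
  sInf {t | ∃ R : Set (Euc (n+1) × Euc (k+1)),
    IsCorrespondence (usphere n) (usphere k) R ∧ t = distortion R}

/-- The mod 2 coboundary of a cochain on finite tuples, `F ↦ (l ↦ ∑ i, F (l without entry i))`. -/
def coboundary {E : Type*} : (List E → ZMod 2) → List E → ZMod 2
  | _, [] => 0
  | F, x :: l => F l + coboundary (fun m => F (x :: m)) l

/-- The prism over a tuple, interpolating between its images under `f` and `g`. -/
def prism {E : Type*} (f g : E → E) : List E → List (List E)
  | [] => []
  | x :: l => (f x :: g x :: l.map g) :: (prism f g l).map (fun m => f x :: m)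

/-- The value of a mod 2 cochain on a mod 2 chain. -/
def evalChain {α : Type*} (c : List α) (F : α → ZMod 2) : ZMod 2 := (c.map F).sum

/-- The cup product of the coboundaries of the `0`-cochains `θ i`, `i < p`, on `(p+1)`-tuples. -/
def cupProd {E : Type*} (θ : ℕ → E → ZMod 2) : List E → ZMod 2
  | [] => 0
  | [_] => 1
  | x :: y :: l => (θ l.length x + θ l.length y) * cupProd θ (y :: l)

/-- A primitive of `cupProd θ`. -/
def cupPrim {E : Type*} (θ : ℕ → E → ZMod 2) : List E → ZMod 2
  | [] => 0
  | x :: l => θ l.length x * cupProd θ (x :: l)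

section Chains

variable {E : Type*}

lemma coboundary_add (F G : List E → ZMod 2) (l : List E) :
    coboundary (fun m => F m + G m) l = coboundary F l + coboundary G l := by
  induction l generalizing F G with
  | nil => simp [coboundary]
  | cons x l ih => simp only [coboundary, ih]; ring

lemma coboundary_const_mul (c : ZMod 2) (F : List E → ZMod 2) (l : List E) :
    coboundary (fun m => c * F m) l = c * coboundary F l := by
  induction l generalizing F with
  | nil => simp [coboundary]
  | cons x l ih => simp only [coboundary, ih]; ring

lemma coboundary_map (g : E → E) (F : List E → ZMod 2) (l : List E) :
    coboundary (fun m => F (m.map g)) l = coboundary F (l.map g) := by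
  induction l generalizing F with
  | nil => simp [coboundary]
  | cons x l ih => simp only [coboundary, List.map_cons, ← ih]

lemma coboundary_congr {F G : List E → ZMod 2} {l : List E}
    (h : ∀ m : List E, m.length + 1 = l.length → F m = G m) :
    coboundary F l = coboundary G l := by
  induction l generalizing F G with
  | nil => simp [coboundary]
  | cons x l ih =>
    simp only [coboundary]
    rw [h l (by simp), ih fun m hm => h (x :: m) (by simp [hm])]

lemma evalChain_add {α : Type*} (c : List α) (F G : α → ZMod 2) :
    evalChain c (fun a => F a + G a) = evalChain c F + evalChain c G := by
  simp [evalChain, List.sum_map_add]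

lemma evalChain_append {α : Type*} (c d : List α) (F : α → ZMod 2) :
    evalChain (c ++ d) F = evalChain c F + evalChain d F := by
  simp [evalChain]

lemma evalChain_map {α β : Type*} (c : List α) (p : α → β) (F : β → ZMod 2) :
    evalChain (c.map p) F = evalChain c (fun a => F (p a)) := by
  simp [evalChain, Function.comp_def]

lemma evalChain_flatMap {α β : Type*} (c : List α) (p : α → List β) (F : β → ZMod 2) :
    evalChain (c.flatMap p) F = evalChain c (fun a => evalChain (p a) F) := by
  induction c with
  | nil => simp [evalChain]
  | cons a c ih => simp_all [evalChain]

lemma evalChain_congr {α : Type*} {c : List α} {F G : α → ZMod 2} (h : ∀ a ∈ c, F a = G a) :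
    evalChain c F = evalChain c G := by
  unfold evalChain
  rw [List.map_congr_left h]

lemma evalChain_range_telescope (a : ℕ → ZMod 2) (n : ℕ) :
    evalChain (List.range n) (fun j => a j + a (j + 1)) = a 0 + a n := by
  induction n with
  | zero => simp [evalChain, CharTwo.add_self_eq_zero]
  | succ n ih =>
    rw [List.range_succ, evalChain_append, ih]
    simp only [evalChain, List.map_cons, List.map_nil, List.sum_cons, List.sum_nil]
    linear_combination CharTwo.add_self_eq_zero (a n)

lemma prism_homotopy (f g : E → E) (F : List E → ZMod 2) (l : List E) :
    evalChain (prism f g l) (coboundary F) + coboundary (fun m => evalChain (prism f g m) F) l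
      = F (l.map f) + F (l.map g) := by
  induction l generalizing F with
  | nil => simp [evalChain, prism, coboundary, CharTwo.add_self_eq_zero]
  | cons x l ih =>
    have h1 : ∀ (c : List (List E)) (a : List E) (G : List E → ZMod 2),
        evalChain (a :: c) G = G a + evalChain c G := fun c a G => by simp [evalChain]
    simp only [prism, coboundary, h1, evalChain_map, evalChain_add, coboundary_add, List.map_cons]
    have h2 := ih (fun m => F (f x :: m))
    have h3 := coboundary_map g (fun m => F (f x :: g x :: m)) l
    rw [h3]
    linear_combination h2 + CharTwo.add_self_eq_zero (F (f x :: l.map g)) +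
      CharTwo.add_self_eq_zero (evalChain (prism f g l) F) +
      CharTwo.add_self_eq_zero (coboundary (fun m => F (f x :: g x :: m)) (l.map g))

lemma mem_prism {f g : E → E} {l m : List E} (hm : m ∈ prism f g l) :
    m.length = l.length + 1 ∧ ∀ x ∈ m, ∃ y ∈ l, x = f y ∨ x = g y := by
  induction l generalizing m with
  | nil => simp [prism] at hm
  | cons a l ih =>
    simp only [prism, List.mem_cons, List.mem_map] at hm
    rcases hm with rfl | ⟨m, hm, rfl⟩
    · simp only [List.length_cons, List.length_map, List.mem_cons, List.mem_map, true_and]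
      rintro x (rfl | rfl | ⟨y, hy, rfl⟩)
      exacts [⟨a, by simp⟩, ⟨a, by simp⟩, ⟨y, by simp [hy]⟩]
    · obtain ⟨h1, h2⟩ := ih hm
      refine ⟨by simp [h1], fun x hx => ?_⟩
      rcases List.mem_cons.1 hx with rfl | hx
      · exact ⟨a, by simp⟩
      · obtain ⟨y, hy, h⟩ := h2 x hx
        exact ⟨y, by simp [hy], h⟩

lemma coboundary_cupProd (θ : ℕ → E → ZMod 2) (l : List E) : coboundary (cupProd θ) l = 0 := by
  induction l with
  | nil => rfl
  | cons x l ih =>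
    cases l with
    | nil => simp [coboundary, cupProd]
    | cons y l =>
      induction l generalizing x y with
      | nil => simp [coboundary, cupProd, CharTwo.add_self_eq_zero]
      | cons z l _ =>
        have h1 : coboundary (fun m => cupProd θ (x :: y :: m)) (z :: l) =
            (θ l.length x + θ l.length y) * coboundary (fun m => cupProd θ (y :: m)) (z :: l) := by
          rw [← coboundary_const_mul]
          refine coboundary_congr fun m hm => ?_
          have : m.length = l.length := by simpa using hm
          simp [cupProd, this]
        rw [coboundary] at ih
        rw [coboundary, coboundary, h1]
        simp only [cupProd] at ih ⊢
        linear_combination (θ l.length x + θ l.length y) * ih +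
          CharTwo.add_self_eq_zero (θ l.length z * cupProd θ (z :: l))

lemma coboundary_cupPrim (θ : ℕ → E → ZMod 2) (x y : E) (l : List E) :
    coboundary (cupPrim θ) (x :: y :: l) = cupProd θ (x :: y :: l) := by
  have h1 : coboundary (fun m => cupPrim θ (x :: y :: m)) l =
      θ l.length x * coboundary (fun m => cupProd θ (x :: y :: m)) l := by
    rw [← coboundary_const_mul]
    refine coboundary_congr fun m hm => ?_
    simp [cupPrim, hm]
  have h2 := coboundary_cupProd θ (x :: y :: l)
  rw [coboundary, coboundary] at h2 ⊢
  rw [h1]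
  have h3 : cupProd θ (x :: y :: l) = (θ l.length x + θ l.length y) * cupProd θ (y :: l) := rfl
  simp only [cupPrim, h3]
  linear_combination θ l.length x * h2 -
    CharTwo.add_self_eq_zero (θ l.length x * cupProd θ (y :: l))

lemma exists_ne_of_cupProd_ne_zero {θ : ℕ → E → ZMod 2} {l : List E} (h : cupProd θ l ≠ 0)
    {i : ℕ} (hi : i + 1 < l.length) : ∃ x ∈ l, ∃ y ∈ l, θ i x ≠ θ i y := by
  induction l with
  | nil => simp at hi
  | cons x l ih =>
    cases l with
    | nil => simp at hi
    | cons y l =>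
      rw [cupProd] at h
      by_cases hil : i = l.length
      · refine ⟨x, by simp, y, by simp, fun hxy => h ?_⟩
        rw [← hil, hxy, CharTwo.add_self_eq_zero, zero_mul]
      · obtain ⟨a, ha, b, hb, hab⟩ := ih (right_ne_zero_of_mul h) (by
          simp only [List.length_cons] at hi ⊢; omega)
        exact ⟨a, by simp [ha], b, by simp [hb], hab⟩

end Chains

section Spheres

variable {E : Type*} [NormedAddCommGroup E] [InnerProductSpace ℝ E]

/-- The point at angle `t` on the great circle arc from `x` to `v`. -/
def rotateTo (v : E) (t : ℝ) (x : E) : E := Real.cos t • x + Real.sin t • v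

lemma norm_rotateTo {v x : E} (hv : ‖v‖ = 1) (hx : ‖x‖ = 1) (h : inner ℝ x v = 0) (t : ℝ) :
    ‖rotateTo v t x‖ = 1 := by
  have h1 : ‖rotateTo v t x‖ ^ 2 = 1 := by
    rw [rotateTo, norm_add_sq_real, norm_smul, norm_smul, inner_smul_left, inner_smul_right, h, hv,
      hx]
    simp
  exact (pow_eq_one_iff_of_nonneg (norm_nonneg _) two_ne_zero).1 h1

lemma norm_rotateTo_sub_le {v x y : E} (hv : ‖v‖ = 1) (hy : ‖y‖ = 1) (s t : ℝ) :
    ‖rotateTo v s x - rotateTo v t y‖ ≤ ‖x - y‖ + 2 * |s - t| := by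
  have h : rotateTo v s x - rotateTo v t y = Real.cos s • (x - y) +
      ((Real.cos s - Real.cos t) • y + (Real.sin s - Real.sin t) • v) := by
    simp only [rotateTo]; module
  rw [h]
  refine (norm_add_le _ _).trans <| add_le_add ?_ <| (norm_add_le _ _).trans ?_
  · rw [norm_smul]
    exact mul_le_of_le_one_left (norm_nonneg _) (Real.abs_cos_le_one s)
  · rw [norm_smul, norm_smul, hv, hy, Real.norm_eq_abs, Real.norm_eq_abs]
    linarith [Real.abs_cos_sub_cos_le s t, Real.abs_sin_sub_sin_le s t]

/-- Inductively in `k`, a fine chain sweeping out a hemisphere of the `k`-sphere spanned by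
`e 0, …, e k`, on which the product of `k` odd classes is nonzero. -/
lemma exists_fine_chain (θ : ℕ → E → ZMod 2) (hθ : ∀ i x, ‖x‖ = 1 → θ i (-x) = θ i x + 1)
    (K : ℕ) (e : ℕ → E) (he : ∀ i ≤ K, ‖e i‖ = 1)
    (he' : ∀ i j, i < j → j ≤ K → inner ℝ (e i) (e j) = 0) {δ : ℝ} (hδ : 0 < δ) (k : ℕ)
    (hk : k ≤ K) :
    ∃ h : List (List E),
      (∀ l ∈ h, l.length = k + 1 ∧
        (∀ x ∈ l, ‖x‖ = 1 ∧ ∀ j, k < j → j ≤ K → inner ℝ x (e j) = 0) ∧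
        ∀ x ∈ l, ∀ y ∈ l, ‖x - y‖ ≤ k * δ) ∧
      (∀ G, evalChain h (coboundary G) +
        evalChain h (fun l => coboundary G (l.map Neg.neg)) = 0) ∧
      evalChain h (cupProd θ) = 1 := by
  induction k with
  | zero =>
    refine ⟨[[e 0]], ?_, ?_, ?_⟩
    · simpa using ⟨he 0 hk, fun j hj hjK => he' 0 j hj hjK⟩
    · intro G
      simp [evalChain, coboundary, CharTwo.add_self_eq_zero]
    · simp [evalChain, cupProd]
  | succ k ih =>
    obtain ⟨h, hmem, hcyc, hone⟩ := ih (by omega)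
    obtain ⟨N, hN⟩ := exists_nat_gt (π / δ)
    have hN0 : (0 : ℝ) < N := lt_of_le_of_lt (by positivity) hN
    set v := e (k + 1)
    have hv1 : ‖v‖ = 1 := he _ hk
    set z := h ++ h.map (List.map Neg.neg) with hz
    set ang : ℕ → ℝ := fun j => π / 2 * j / N with hang
    set h' := (List.range N).flatMap fun j =>
      z.flatMap (prism (rotateTo v (ang j)) (rotateTo v (ang (j + 1)))) with hh'
    have hzev : ∀ F, evalChain z F = evalChain h F + evalChain h (fun l => F (l.map Neg.neg)) :=
      fun F => by rw [hz, evalChain_append, evalChain_map]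
    have hzmem : ∀ l ∈ z, l.length = k + 1 ∧
        (∀ x ∈ l, ‖x‖ = 1 ∧ ∀ j, k < j → j ≤ K → inner ℝ x (e j) = 0) ∧
        ∀ x ∈ l, ∀ y ∈ l, ‖x - y‖ ≤ k * δ := by
      intro l hl
      rcases List.mem_append.1 hl with hl | hl
      · exact hmem l hl
      · obtain ⟨l, hl', rfl⟩ := List.mem_map.1 hl
        obtain ⟨h1, h2, h3⟩ := hmem l hl'
        refine ⟨by simpa using h1, ?_, ?_⟩
        · intro x hx
          obtain ⟨x, hx', rfl⟩ := List.mem_map.1 hx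
          simpa using h2 x hx'
        · intro x hx y hy
          obtain ⟨x, hx', rfl⟩ := List.mem_map.1 hx
          obtain ⟨y, hy', rfl⟩ := List.mem_map.1 hy
          rw [neg_sub_neg, norm_sub_rev]
          exact h3 x hx' y hy'
    have hbd : ∀ F, evalChain h' (coboundary F) = evalChain z F := by
      intro F
      have h1 : ∀ j, evalChain z (fun l => evalChain
          (prism (rotateTo v (ang j)) (rotateTo v (ang (j + 1))) l) (coboundary F)) =
          evalChain z (fun l => F (l.map (rotateTo v (ang j)))) +
          evalChain z (fun l => F (l.map (rotateTo v (ang (j + 1))))) := by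
        intro j
        have h2 := hcyc fun m => evalChain
          (prism (rotateTo v (ang j)) (rotateTo v (ang (j + 1))) m) F
        rw [← hzev] at h2
        rw [← evalChain_add]
        simp_rw [← prism_homotopy]
        rw [evalChain_add, h2, add_zero]
      simp_rw [hh', evalChain_flatMap, h1]
      rw [evalChain_range_telescope (fun j => evalChain z (fun l => F (l.map (rotateTo v (ang j)))))]
      have h0 : rotateTo v (ang 0) = id := by
        ext x; simp [rotateTo, hang]
      have hNv : ∀ l ∈ h, F (l.map (rotateTo v (ang N))) = F (List.replicate (k + 1) v) ∧
          F ((l.map Neg.neg).map (rotateTo v (ang N))) = F (List.replicate (k + 1) v) := by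
        have hr : rotateTo v (ang N) = fun _ => v := by
          ext x
          have : ang N = π / 2 := by simp only [hang]; field_simp
          simp [rotateTo, this]
        intro l hl
        simp only [hr, List.map_const', List.length_map, (hmem l hl).1, and_self]
      simp only [h0, List.map_id]
      have : evalChain z (fun l => F (l.map (rotateTo v (ang N)))) = 0 := by
        rw [hzev, evalChain_congr fun l hl => (hNv l hl).1,
          evalChain_congr fun l hl => (hNv l hl).2, CharTwo.add_self_eq_zero]
      rw [this, add_zero]
    have hmem' : ∀ l ∈ h', l.length = k + 1 + 1 ∧
        (∀ x ∈ l, ‖x‖ = 1 ∧ ∀ j, k + 1 < j → j ≤ K → inner ℝ x (e j) = 0) ∧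
        ∀ x ∈ l, ∀ y ∈ l, ‖x - y‖ ≤ ↑(k + 1) * δ := by
      intro l hl
      rw [hh'] at hl
      simp only [List.mem_flatMap] at hl
      obtain ⟨j, -, m, hm, hl⟩ := hl
      obtain ⟨h1, h2⟩ := mem_prism hl
      obtain ⟨m1, m2, m3⟩ := hzmem m hm
      have h3 : ∀ x ∈ l, ∃ y ∈ m, ∃ i, (i = j ∨ i = j + 1) ∧ x = rotateTo v (ang i) y := by
        intro x hx
        obtain ⟨y, hy, h | h⟩ := h2 x hx
        exacts [⟨y, hy, j, by simp, h⟩, ⟨y, hy, j + 1, by simp, h⟩]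
      refine ⟨by rw [h1, m1], ?_, ?_⟩
      · intro x hx
        obtain ⟨y, hy, i, -, rfl⟩ := h3 x hx
        obtain ⟨y1, y2⟩ := m2 y hy
        refine ⟨norm_rotateTo hv1 y1 (y2 _ (by omega) hk) _, fun i hi hiK => ?_⟩
        rw [rotateTo, inner_add_left, inner_smul_left, inner_smul_left, y2 i (by omega) hiK,
          he' _ _ hi hiK]
        simp
      · intro x hx y hy
        obtain ⟨a, ha, i, hi, rfl⟩ := h3 x hx
        obtain ⟨b, hb, i', hi', rfl⟩ := h3 y hy
        refine (norm_rotateTo_sub_le hv1 (m2 b hb).1 _ _).trans ?_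
        have h4 := m3 a ha b hb
        have h5 : 2 * |ang i - ang i'| ≤ δ := by
          have h6 : ang i - ang i' = π / 2 / N * ((i : ℝ) - i') := by simp only [hang]; ring
          have h7 : |(i : ℝ) - i'| ≤ 1 := by
            rw [abs_le]
            rcases hi with rfl | rfl <;> rcases hi' with rfl | rfl <;> push_cast <;>
              constructor <;> linarith
          rw [h6, abs_mul, abs_of_nonneg (by positivity : (0 : ℝ) ≤ π / 2 / N)]
          have h8 : π / N < δ := by
            rw [div_lt_iff₀ hδ] at hN
            rw [div_lt_iff₀ hN0]; linarith
          have h9 : (0 : ℝ) ≤ π / N := by positivity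
          calc 2 * (π / 2 / N * |(i : ℝ) - i'|) = π / N * |(i : ℝ) - i'| := by ring
            _ ≤ π / N * 1 := by gcongr
            _ ≤ δ := by linarith
        push_cast
        linarith
    refine ⟨h', hmem', fun G => ?_, ?_⟩
    · have h1 : (fun l => coboundary G (l.map Neg.neg)) =
          coboundary (fun l : List E => G (l.map Neg.neg)) :=
        funext fun l => (coboundary_map _ _ _).symm
      rw [h1, hbd, hbd, hzev, hzev]
      have h2 : ∀ l : List E, (l.map Neg.neg).map Neg.neg = l := fun l => by simp
      simp only [h2]
      linear_combination CharTwo.add_self_eq_zero (evalChain h G) +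
        CharTwo.add_self_eq_zero (evalChain h fun l => G (l.map Neg.neg))
    · have h1 : evalChain h' (cupProd θ) = evalChain h' (coboundary (cupPrim θ)) := by
        refine evalChain_congr fun l hl => ?_
        obtain ⟨h2, -, -⟩ := hmem' l hl
        match l, h2 with
        | x :: y :: l, _ => rw [coboundary_cupPrim]
      have hneg : ∀ l : List E, (∀ x ∈ l, ‖x‖ = 1) → cupProd θ (l.map Neg.neg) = cupProd θ l := by
        intro l
        induction l with
        | nil => simp
        | cons x l ihl =>
          cases l with
          | nil => simp [cupProd]
          | cons y l =>
            intro hl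
            have := ihl fun a ha => hl a (List.mem_cons_of_mem _ ha)
            simp only [List.map_cons] at this
            simp only [List.map_cons, cupProd, List.length_map, this,
              hθ _ x (hl x (by simp)), hθ _ y (hl y (by simp))]
            linear_combination CharTwo.add_self_eq_zero (cupProd θ (y :: l))
      rw [h1, hbd, hzev, ← evalChain_add, ← hone]
      refine evalChain_congr fun l hl => ?_
      obtain ⟨h2, h3, -⟩ := hmem l hl
      have h4 := hneg l fun x hx => (h3 x hx).1
      match l, h2, h3, h4 with
      | x :: l, _, h3, h4 =>
        simp only [List.map_cons] at h4
        simp only [cupPrim, List.map_cons, h4, hθ _ x (h3 x (by simp)).1, List.length_map]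
        linear_combination CharTwo.add_self_eq_zero (θ l.length x * cupProd θ (x :: l))

end Spheres

/-- A function that distinguishes every vector from its negative if the two differ. -/
lemma exists_odd_sign (E : Type*) [InvolutiveNeg E] :
    ∃ σ : E → ZMod 2, ∀ x, x ≠ -x → σ (-x) = σ x + 1 := by
  classical
  refine ⟨fun x => if (Quot.out s(x, -x)).1 = x then 1 else 0, fun x hne => ?_⟩
  have h1 : (Quot.out s(x, -x)).1 = x ∨ (Quot.out s(x, -x)).1 = -x := by
    simpa using Sym2.out_fst_mem s(x, -x)
  have h2 : s(-x, - -x) = s(x, -x) := by rw [neg_neg, Sym2.eq_swap]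
  simp only [h2]
  rcases h1 with h | h
  · rw [h, if_neg hne, if_pos rfl]; rfl
  · rw [h, if_pos rfl, if_neg hne.symm]; rfl

/-- Lusternik–Schnirelmann: if the `k`-sphere is divided into `k` pieces, one of the pieces contains
pairs of points that are arbitrarily close to being antipodal. -/
theorem exists_nearly_antipodal {k : ℕ} (c : Euc (k + 1) → ℕ) (hc : ∀ x, ‖x‖ = 1 → c x < k)
    {ε : ℝ} (hε : 0 < ε) :
    ∃ x y : Euc (k + 1), ‖x‖ = 1 ∧ ‖y‖ = 1 ∧ c x = c y ∧ ‖x + y‖ ≤ ε := by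
  classical
  by_contra! hcon
  obtain ⟨σ, hσ⟩ := exists_odd_sign (Euc (k + 1))
  set near : ℕ → Euc (k + 1) → Prop :=
    fun i x => ∃ y : Euc (k + 1), ‖y‖ = 1 ∧ c y = i ∧ ‖x - y‖ ≤ ε / 2
  have hdisj : ∀ i x, near i x → ¬ near i (-x) := by
    rintro i x ⟨y, hy, hyi, hxy⟩ ⟨y', hy', hyi', hxy'⟩
    have h1 := hcon y y' hy hy' (hyi.trans hyi'.symm)
    have h2 : y + y' = -((x - y) + (-x - y')) := by abel
    rw [h2, norm_neg] at h1
    linarith [norm_add_le (x - y) (-x - y')]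
  set θ : ℕ → Euc (k + 1) → ZMod 2 :=
    fun i x => if near i x then 1 else if near i (-x) then 0 else σ x with hθdef
  have hθ : ∀ i x, ‖x‖ = 1 → θ i (-x) = θ i x + 1 := by
    intro i x hx
    have hx0 : x ≠ -x := fun h => by
      have h2 : (2 : ℝ) • x = 0 := by rw [two_smul, ← sub_neg_eq_add, ← h, sub_self]
      have h3 : x = 0 := (smul_eq_zero.1 h2).resolve_left two_ne_zero
      simp [h3] at hx
    by_cases h1 : near i x
    · simp only [hθdef, neg_neg, h1, hdisj i x h1, if_true, if_false]; rfl
    · by_cases h2 : near i (-x)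
      · simp [hθdef, h1, h2]
      · simp [hθdef, h1, h2, hσ x hx0]
  set e : ℕ → Euc (k + 1) := fun j => EuclideanSpace.single (Fin.ofNat (k + 1) j) 1 with he
  obtain ⟨h, hmem, -, hone⟩ := exists_fine_chain θ hθ k e (fun i _ => by simp [he])
    (fun i j hij hj => by
      have : Fin.ofNat (k + 1) i ≠ Fin.ofNat (k + 1) j := by
        intro h
        have := congrArg Fin.val h
        simp only [Fin.val_ofNat] at this
        rw [Nat.mod_eq_of_lt (by omega), Nat.mod_eq_of_lt (by omega)] at this
        omega
      simpa [he, EuclideanSpace.inner_single_left] using this)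
    (δ := ε / 2 / (k + 1)) (by positivity) k le_rfl
  obtain ⟨l, hl, hl0⟩ : ∃ l ∈ h, cupProd θ l ≠ 0 := by
    by_contra! h0
    rw [evalChain_congr (G := fun _ => 0) h0] at hone
    simp [evalChain] at hone
  obtain ⟨hlen, hunit, hclose⟩ := hmem l hl
  obtain ⟨x₀, hx₀⟩ : ∃ x, x ∈ l := List.exists_mem_of_ne_nil l (by rintro rfl; simp at hlen)
  have hn : ∀ x ∈ l, θ (c x₀) x = 1 := by
    intro x hx
    refine if_pos ⟨x₀, (hunit x₀ hx₀).1, rfl, (hclose x hx x₀ hx₀).trans ?_⟩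
    rw [mul_div_assoc', div_le_iff₀ (by positivity)]
    nlinarith
  obtain ⟨x, hx, y, hy, hxy⟩ := exists_ne_of_cupProd_ne_zero hl0 (i := c x₀) (by
    have := hc x₀ (hunit x₀ hx₀).1; omega)
  exact hxy ((hn x hx).trans (hn y hy).symm)

lemma mem_usphere {n : ℕ} {x : Euc (n + 1)} : x ∈ usphere n ↔ ‖x‖ = 1 := by
  rw [usphere, Set.mem_ofPred_eq, real_inner_self_eq_norm_sq]
  exact pow_eq_one_iff_of_nonneg (norm_nonneg _) two_ne_zero

lemma inner_eq_one_sub_norm_sub_sq {d : ℕ} {x y : Euc d} (hx : ‖x‖ = 1) (hy : ‖y‖ = 1) :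
    inner ℝ x y = 1 - ‖x - y‖ ^ 2 / 2 := by
  rw [norm_sub_sq_real, hx, hy]; ring

lemma geoDist_nonneg {d : ℕ} (x y : Euc d) : 0 ≤ geoDist x y := Real.arccos_nonneg _

lemma geoDist_le_pi {d : ℕ} (x y : Euc d) : geoDist x y ≤ π := Real.arccos_le_pi _

lemma geoDist_neg_right {d : ℕ} (x y : Euc d) : geoDist x (-y) = π - geoDist x y := by
  rw [geoDist, inner_neg_right, Real.arccos_neg, geoDist]

/-- Jordan's inequality comparing arc length with chord length. -/
lemma geoDist_le_mul_norm_sub {d : ℕ} {x y : Euc d} (hx : ‖x‖ = 1) (hy : ‖y‖ = 1) :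
    geoDist x y ≤ π / 2 * ‖x - y‖ := by
  have h0 := geoDist_nonneg x y
  have hb := abs_real_inner_le_norm x y
  rw [hx, hy, one_mul, abs_le] at hb
  have h1 : Real.cos (geoDist x y) = 1 - ‖x - y‖ ^ 2 / 2 := by
    rw [geoDist, Real.cos_arccos hb.1 hb.2, inner_eq_one_sub_norm_sub_sq hx hy]
  have h2 := Real.cos_le_one_sub_mul_cos_sq
    (show |geoDist x y| ≤ π by rw [abs_of_nonneg h0]; exact geoDist_le_pi x y)
  rw [h1] at h2
  have hpi := Real.pi_pos
  refine abs_le_of_sq_le_sq' ?_ (by positivity) |>.2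
  have h3 : 2 / π ^ 2 * geoDist x y ^ 2 ≤ ‖x - y‖ ^ 2 / 2 := by linarith
  rw [div_mul_eq_mul_div, div_le_iff₀ (by positivity)] at h3
  nlinarith

lemma distortion_bddAbove {d₁ d₂ : ℕ} (R : Set (Euc d₁ × Euc d₂)) :
    BddAbove {t | ∃ z ∈ R, ∃ w ∈ R, t = |geoDist z.1 w.1 - geoDist z.2 w.2|} := by
  refine ⟨π, ?_⟩
  rintro t ⟨z, -, w, -, rfl⟩
  rw [abs_le]
  constructor <;> linarith [geoDist_nonneg z.1 w.1, geoDist_nonneg z.2 w.2,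
    geoDist_le_pi z.1 w.1, geoDist_le_pi z.2 w.2]

lemma distortion_nonneg {d₁ d₂ : ℕ} (R : Set (Euc d₁ × Euc d₂)) : 0 ≤ distortion R := by
  refine Real.sSup_nonneg ?_
  rintro t ⟨z, -, w, -, rfl⟩
  exact abs_nonneg _

lemma isCorrespondence_prod (n k : ℕ) :
    IsCorrespondence (usphere n) (usphere k) (usphere n ×ˢ usphere k) := by
  have hne : ∀ m, EuclideanSpace.single 0 1 ∈ usphere m := fun m => by simp [mem_usphere]
  exact ⟨fun z hz => hz, fun a ha => ⟨_, hne k, ha, hne k⟩, fun b hb => ⟨_, hne n, hne n, hb⟩⟩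

/-- Lower bounds on `twoGH` follow from uniform lower bounds on distortions. -/
lemma le_twoGH {n k : ℕ} {D : ℝ}
    (h : ∀ R, IsCorrespondence (usphere n) (usphere k) R → D ≤ distortion R) : D ≤ twoGH n k := by
  refine le_csInf ⟨_, _, isCorrespondence_prod n k, rfl⟩ ?_
  rintro t ⟨R, hR, rfl⟩
  exact h R hR

lemma twoGH_le_distortion {n k : ℕ} {R : Set (Euc (n + 1) × Euc (k + 1))}
    (hR : IsCorrespondence (usphere n) (usphere k) R) : twoGH n k ≤ distortion R := by
  refine csInf_le ⟨0, ?_⟩ ⟨R, hR, rfl⟩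
  rintro t ⟨R, -, rfl⟩
  exact distortion_nonneg R

/-- The polar and azimuthal angles of a point of the `2`-sphere. -/
def sphericalAngles (u : Euc 3) : ℝ × ℝ := (Real.arccos (u 2), Complex.arg ⟨u 0, u 1⟩)

lemma norm_sq_eq_of_fin_three (u : Euc 3) : ‖u‖ ^ 2 = u 0 ^ 2 + u 1 ^ 2 + u 2 ^ 2 := by
  rw [EuclideanSpace.norm_sq_eq, Fin.sum_univ_three]; simp

lemma eq_of_sphericalAngles {u : Euc 3} (hu : ‖u‖ = 1) :
    u 0 = Real.sin (sphericalAngles u).1 * Real.cos (sphericalAngles u).2 ∧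
    u 1 = Real.sin (sphericalAngles u).1 * Real.sin (sphericalAngles u).2 ∧
    u 2 = Real.cos (sphericalAngles u).1 := by
  have h1 := norm_sq_eq_of_fin_three u
  rw [hu] at h1
  have h2 : ‖(⟨u 0, u 1⟩ : ℂ)‖ = Real.sin (sphericalAngles u).1 := by
    rw [sphericalAngles, Real.sin_arccos, Complex.norm_eq_sqrt_sq_add_sq]
    congr 1; simp only; linarith
  refine ⟨?_, ?_, ?_⟩
  · rw [← h2, sphericalAngles, Complex.norm_mul_cos_arg]
  · rw [← h2, sphericalAngles, Complex.norm_mul_sin_arg]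
  · rw [sphericalAngles, Real.cos_arccos] <;> nlinarith [sq_nonneg (u 0), sq_nonneg (u 1)]

lemma norm_sub_le_of_sphericalAngles {u u' : Euc 3} (hu : ‖u‖ = 1) (hu' : ‖u'‖ = 1) {r : ℝ}
    (h1 : |(sphericalAngles u).1 - (sphericalAngles u').1| ≤ r)
    (h2 : |(sphericalAngles u).2 - (sphericalAngles u').2| ≤ r) : ‖u - u'‖ ≤ 3 * r := by
  have hprod : ∀ a a' b b' : ℝ, |a'| ≤ 1 → |b| ≤ 1 → |a - a'| ≤ r → |b - b'| ≤ r →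
      |a * b - a' * b'| ≤ 2 * r := by
    intro a a' b b' ha' hb hab hbb
    have : a * b - a' * b' = (a - a') * b + a' * (b - b') := by ring
    rw [this]
    refine (abs_add_le _ _).trans ?_
    rw [abs_mul, abs_mul]
    nlinarith [abs_nonneg (a - a'), abs_nonneg (b - b'), abs_nonneg a', abs_nonneg b]
  obtain ⟨e0, e1, e2⟩ := eq_of_sphericalAngles hu
  obtain ⟨e0', e1', e2'⟩ := eq_of_sphericalAngles hu'
  set φ := (sphericalAngles u).1
  set ψ := (sphericalAngles u).2
  set φ' := (sphericalAngles u').1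
  set ψ' := (sphericalAngles u').2
  have hr : 0 ≤ r := (abs_nonneg _).trans h1
  have d0 : |u 0 - u' 0| ≤ 2 * r := by
    rw [e0, e0']
    exact hprod _ _ _ _ (Real.abs_sin_le_one _) (Real.abs_cos_le_one _)
      ((Real.abs_sin_sub_sin_le _ _).trans h1) ((Real.abs_cos_sub_cos_le _ _).trans h2)
  have d1 : |u 1 - u' 1| ≤ 2 * r := by
    rw [e1, e1']
    exact hprod _ _ _ _ (Real.abs_sin_le_one _) (Real.abs_sin_le_one _)
      ((Real.abs_sin_sub_sin_le _ _).trans h1) ((Real.abs_sin_sub_sin_le _ _).trans h2)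
  have d2 : |u 2 - u' 2| ≤ r := by
    rw [e2, e2']
    exact (Real.abs_cos_sub_cos_le _ _).trans h1
  refine abs_le_of_sq_le_sq' ?_ (by positivity) |>.2
  rw [norm_sq_eq_of_fin_three]
  simp only [PiLp.sub_apply]
  rw [← sq_abs (u 0 - u' 0), ← sq_abs (u 1 - u' 1), ← sq_abs (u 2 - u' 2)]
  nlinarith [abs_nonneg (u 0 - u' 0), abs_nonneg (u 1 - u' 1), abs_nonneg (u 2 - u' 2)]

/-- The `2`-sphere can be divided into `N ^ 2` pieces of diameter `O(1 / N)`. -/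
lemma exists_small_pieces {N : ℕ} (hN : 0 < N) :
    ∃ c : Euc 3 → ℕ, (∀ u, c u < N ^ 2) ∧
      ∀ u u', ‖u‖ = 1 → ‖u'‖ = 1 → c u = c u' → ‖u - u'‖ ≤ 21 / N := by
  have hN' : (0 : ℝ) < N := by exact_mod_cast hN
  have hlt : ∀ t : ℝ, 0 ≤ t → t < 7 → ⌊t / 7 * N⌋₊ < N := by
    intro t h0 h7
    rw [Nat.floor_lt (by positivity)]
    nlinarith
  have hclose : ∀ s t : ℝ, 0 ≤ s → 0 ≤ t → ⌊s / 7 * N⌋₊ = ⌊t / 7 * N⌋₊ → |s - t| ≤ 7 / N := by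
    intro s t hs ht hst
    have h1 := Nat.floor_le (show 0 ≤ s / 7 * N by positivity)
    have h2 := Nat.lt_floor_add_one (s / 7 * N)
    have h3 := Nat.floor_le (show 0 ≤ t / 7 * N by positivity)
    have h4 := Nat.lt_floor_add_one (t / 7 * N)
    rw [hst] at h1 h2
    rw [le_div_iff₀ hN', ← abs_of_pos hN', ← abs_mul, abs_le]
    constructor <;> linarith
  set A : Euc 3 → ℝ := fun u => (sphericalAngles u).1
  set B : Euc 3 → ℝ := fun u => (sphericalAngles u).2 + π
  have hA0 : ∀ u, 0 ≤ A u := fun u => Real.arccos_nonneg _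
  have hB0 : ∀ u, 0 ≤ B u := fun u => by
    have := Complex.neg_pi_lt_arg ⟨u 0, u 1⟩
    simp only [B, sphericalAngles]; linarith
  have hpi := Real.pi_lt_d2
  have hA7 : ∀ u, A u < 7 := fun u => by
    have := Real.arccos_le_pi (u 2)
    simp only [A, sphericalAngles]; linarith
  have hB7 : ∀ u, B u < 7 := fun u => by
    have := Complex.arg_le_pi ⟨u 0, u 1⟩
    simp only [B, sphericalAngles]; linarith
  refine ⟨fun u => ⌊A u / 7 * N⌋₊ * N + ⌊B u / 7 * N⌋₊, fun u => ?_, fun u u' hu hu' h => ?_⟩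
  · have h1 := hlt _ (hA0 u) (hA7 u)
    have h2 := hlt _ (hB0 u) (hB7 u)
    simp only
    nlinarith
  · have hb := hlt _ (hB0 u) (hB7 u)
    have hb' := hlt _ (hB0 u') (hB7 u')
    have h1 : ⌊A u / 7 * N⌋₊ = ⌊A u' / 7 * N⌋₊ := by
      have := congrArg (· / N) h
      simpa [Nat.add_div_of_dvd_right, hN, Nat.div_eq_of_lt hb, Nat.div_eq_of_lt hb'] using this
    have h2 : ⌊B u / 7 * N⌋₊ = ⌊B u' / 7 * N⌋₊ := by
      simp only [h1] at h
      omega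
    have h3 := hclose _ _ (hA0 u) (hA0 u') h1
    have h4 := hclose _ _ (hB0 u) (hB0 u') h2
    have h5 := norm_sub_le_of_sphericalAngles hu hu' h3 (by simpa [B] using h4)
    calc ‖u - u'‖ ≤ 3 * (7 / N) := h5
      _ = 21 / N := by ring

/-- Any correspondence between the `2`-sphere and the `k`-sphere has large distortion. -/
theorem le_distortion {k : ℕ} (hk : 0 < k) {R : Set (Euc (2 + 1) × Euc (k + 1))}
    (hR : IsCorrespondence (usphere 2) (usphere k) R) :
    π - 21 * π / Real.sqrt k ≤ distortion R := by
  obtain ⟨hsub, -, hsurj⟩ := hR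
  choose! g hg hgR using hsurj
  have hN : 0 < Nat.sqrt k := Nat.sqrt_pos.2 hk
  obtain ⟨c, hc, hdiam⟩ := exists_small_pieces hN
  have hN' : (0 : ℝ) < Nat.sqrt k := by exact_mod_cast hN
  have hsq : Real.sqrt k ≤ 2 * Nat.sqrt k := by
    have h1 := Real.real_sqrt_lt_nat_sqrt_succ (a := k)
    have h2 : (1 : ℝ) ≤ Nat.sqrt k := by exact_mod_cast hN
    linarith
  have hpi := Real.pi_pos
  have hbound : π / 2 * (21 / Nat.sqrt k) ≤ 21 * π / Real.sqrt k := by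
    rw [div_mul_div_comm, div_le_div_iff₀ (by positivity)
      (Real.sqrt_pos.2 (by exact_mod_cast hk))]
    nlinarith
  refine le_of_forall_pos_sub_le fun ε hε => ?_
  obtain ⟨x, y, hx, hy, hxy, hclose⟩ := exists_nearly_antipodal (fun x => c (g x))
    (fun x _ => (hc _).trans_le (Nat.sqrt_le' k)) (ε := 2 / π * ε) (by positivity)
  have hgx := mem_usphere.1 (hg x (mem_usphere.2 hx))
  have hgy := mem_usphere.1 (hg y (mem_usphere.2 hy))
  have h1 : geoDist (g x) (g y) ≤ 21 * π / Real.sqrt k :=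
    ((geoDist_le_mul_norm_sub hgx hgy).trans (by gcongr; exact hdiam _ _ hgx hgy hxy)).trans hbound
  have h2 : π - geoDist x y ≤ ε := by
    rw [← geoDist_neg_right]
    refine (geoDist_le_mul_norm_sub hx (by rwa [norm_neg])).trans ?_
    rw [sub_neg_eq_add]
    calc π / 2 * ‖x + y‖ ≤ π / 2 * (2 / π * ε) := by gcongr
      _ = ε := by field_simp
  have h3 : |geoDist (g x) (g y) - geoDist x y| ≤ distortion R :=
    le_csSup (distortion_bddAbove R) ⟨(g x, x), hgR x (mem_usphere.2 hx), (g y, y),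
      hgR y (mem_usphere.2 hy), rfl⟩
  have h4 := neg_abs_le (geoDist (g x) (g y) - geoDist x y)
  linarith

/-- Integer vectors spanning pairwise well separated lines in `ℝ³`: the coordinate axes, and the
points of an `n × n` grid at height `n`. -/
def gridVec (n : ℕ) : ℕ → ℝ × ℝ × ℝ
  | 0 => (n, 0, 0)
  | 1 => (0, n, 0)
  | 2 => (0, 0, n)
  | j + 3 => ((j / n : ℕ), (j % n : ℕ) + 1, n)

/-- The squared norm of a vector of `ℝ³`. -/
def tripleNormSq (v : ℝ × ℝ × ℝ) : ℝ := v.1 ^ 2 + v.2.1 ^ 2 + v.2.2 ^ 2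

/-- The inner product of two vectors of `ℝ³`. -/
def tripleDot (v w : ℝ × ℝ × ℝ) : ℝ := v.1 * w.1 + v.2.1 * w.2.1 + v.2.2 * w.2.2

/-- The squared norm of the cross product of two vectors of `ℝ³`. -/
def crossNormSq (v w : ℝ × ℝ × ℝ) : ℝ :=
  (v.2.1 * w.2.2 - v.2.2 * w.2.1) ^ 2 + (v.1 * w.2.2 - v.2.2 * w.1) ^ 2 +
    (v.1 * w.2.1 - v.2.1 * w.1) ^ 2

lemma tripleDot_sq (v w : ℝ × ℝ × ℝ) :
    tripleDot v w ^ 2 = tripleNormSq v * tripleNormSq w - crossNormSq v w := by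
  simp only [tripleDot, tripleNormSq, crossNormSq]; ring

lemma tripleNormSq_gridVec {n j : ℕ} (hj : j < n ^ 2) :
    (n : ℝ) ^ 2 ≤ tripleNormSq (gridVec n j) ∧ tripleNormSq (gridVec n j) ≤ 3 * n ^ 2 := by
  have hn : 0 < n := Nat.pos_of_ne_zero (by rintro rfl; simp at hj)
  match j with
  | 0 | 1 | 2 => simp [gridVec, tripleNormSq]; nlinarith [sq_nonneg (n : ℝ)]
  | j + 3 =>
    have h1 : ((j / n : ℕ) : ℝ) ≤ n := by
      have : j / n < n := Nat.div_lt_of_lt_mul (by nlinarith)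
      exact_mod_cast this.le
    have h2 : ((j % n : ℕ) : ℝ) + 1 ≤ n := by exact_mod_cast Nat.mod_lt j hn
    have h3 : (0 : ℝ) ≤ (j / n : ℕ) := by positivity
    have h4 : (0 : ℝ) ≤ (j % n : ℕ) := by positivity
    simp only [gridVec, tripleNormSq]
    constructor <;> nlinarith

lemma sq_natCast_le_crossNormSq {n i j : ℕ} (hij : i < j) (hj : j < n ^ 2) :
    (n : ℝ) ^ 2 ≤ crossNormSq (gridVec n i) (gridVec n j) := by
  have hn : 0 < n := Nat.pos_of_ne_zero (by rintro rfl; simp at hj)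
  have hn1 : (1 : ℝ) ≤ n := by exact_mod_cast hn
  have hn2 : (n : ℝ) ^ 2 ≤ (n * n) ^ 2 := by
    gcongr; nlinarith
  match i, j with
  | 0, 1 | 0, 2 | 1, 2 => simp [gridVec, crossNormSq]; linarith
  | 0, j + 3 | 1, j + 3 =>
    simp only [gridVec, crossNormSq]
    ring_nf at hn2 ⊢
    nlinarith [sq_nonneg ((n : ℝ) * (j % n : ℕ)), sq_nonneg ((n : ℝ) * (j / n : ℕ)),
      show (0 : ℝ) ≤ n ^ 2 * (j % n : ℕ) by positivity]
  | 2, j + 3 =>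
    have h4 : (0 : ℝ) ≤ (j % n : ℕ) := by positivity
    simp only [gridVec, crossNormSq]
    nlinarith [sq_nonneg ((n : ℝ) * (j / n : ℕ)), mul_nonneg (sq_nonneg (n : ℝ)) h4,
      mul_nonneg (sq_nonneg (n : ℝ)) (sq_nonneg ((j % n : ℕ) : ℝ))]
  | i + 3, j + 3 =>
    have key : ∀ a b : ℕ, a ≠ b → (n : ℝ) ^ 2 ≤ ((a : ℝ) * n - n * b) ^ 2 := by
      intro a b hab
      have h1 : (1 : ℝ) ≤ ((a : ℝ) - b) ^ 2 := by
        have h2 : (1 : ℤ) ≤ ((a : ℤ) - b) ^ 2 := by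
          have : (a : ℤ) - b ≠ 0 := sub_ne_zero.2 (by exact_mod_cast hab)
          have := sq_pos_of_ne_zero this
          omega
        exact_mod_cast h2
      nlinarith [sq_nonneg (n : ℝ)]
    simp only [gridVec, crossNormSq]
    by_cases h : i / n = j / n
    · have h2 : i % n ≠ j % n := fun h2 => by
        have := Nat.div_add_mod i n
        have := Nat.div_add_mod j n
        rw [h, h2] at *
        omega
      have h3 := key (i % n + 1) (j % n + 1) (by omega)
      push_cast at h3
      refine h3.trans ?_
      rw [add_assoc]
      exact le_add_of_nonneg_right (by positivity)
    · have h3 := key _ _ h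
      refine h3.trans ?_
      rw [add_right_comm]
      exact le_add_of_nonneg_left (by positivity)

/-- The unit vector in direction `gridVec n j`. -/
def gridPoint (n j : ℕ) : Euc 3 :=
  (Real.sqrt (tripleNormSq (gridVec n j)))⁻¹ •
    !₂[(gridVec n j).1, (gridVec n j).2.1, (gridVec n j).2.2]

lemma inner_gridPoint (n i j : ℕ) : inner ℝ (gridPoint n i) (gridPoint n j) =
    tripleDot (gridVec n i) (gridVec n j) /
      (Real.sqrt (tripleNormSq (gridVec n i)) * Real.sqrt (tripleNormSq (gridVec n j))) := by
  simp only [gridPoint, inner_smul_left, inner_smul_right, PiLp.inner_apply, Fin.sum_univ_three]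
  simp [tripleDot]
  field_simp

lemma norm_gridPoint {n j : ℕ} (hj : j < n ^ 2) : ‖gridPoint n j‖ = 1 := by
  have hn : 0 < n := Nat.pos_of_ne_zero (by rintro rfl; simp at hj)
  have h1 : 0 < tripleNormSq (gridVec n j) :=
    lt_of_lt_of_le (by positivity) (tripleNormSq_gridVec hj).1
  rw [← pow_eq_one_iff_of_nonneg (norm_nonneg _) two_ne_zero, ← real_inner_self_eq_norm_sq,
    inner_gridPoint, Real.mul_self_sqrt h1.le, div_eq_one_iff_eq h1.ne']
  simp only [tripleDot, tripleNormSq]; ring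

lemma abs_inner_gridPoint_le {n i j : ℕ} (hi : i < n ^ 2) (hj : j < n ^ 2) (hij : i ≠ j) :
    |inner ℝ (gridPoint n i) (gridPoint n j)| ≤ 1 - 1 / (18 * n ^ 2) := by
  wlog h : i < j generalizing i j
  · rw [real_inner_comm]
    exact this hj hi hij.symm (by omega)
  have hn : 0 < n := Nat.pos_of_ne_zero (by rintro rfl; simp at hj)
  have hn0 : (1 : ℝ) ≤ n := by exact_mod_cast hn
  obtain ⟨a1, a2⟩ := tripleNormSq_gridVec hi
  obtain ⟨b1, b2⟩ := tripleNormSq_gridVec hj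
  have hc := sq_natCast_le_crossNormSq h hj
  have hd := tripleDot_sq (gridVec n i) (gridVec n j)
  set A := tripleNormSq (gridVec n i)
  set B := tripleNormSq (gridVec n j)
  have hA : 0 < A := lt_of_lt_of_le (by positivity) a1
  have hB : 0 < B := lt_of_lt_of_le (by positivity) b1
  set t : ℝ := 1 / (18 * n ^ 2) with ht
  have ht1 : t * n ^ 2 = 1 / 18 := by rw [ht]; field_simp
  have ht0 : t ≤ 1 / 18 := by
    rw [ht]; gcongr; nlinarith
  have ht0' : 0 ≤ t := by positivity
  have hAB : A * B ≤ 9 * (n ^ 2) ^ 2 := by nlinarith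
  refine abs_le_of_sq_le_sq ?_ (by linarith)
  rw [inner_gridPoint, div_pow, mul_pow, Real.sq_sqrt hA.le, Real.sq_sqrt hB.le, hd,
    div_le_iff₀ (by positivity)]
  have h1 : 2 * t * (A * B) ≤ n ^ 2 := by
    calc 2 * t * (A * B) ≤ 2 * t * (9 * (n ^ 2) ^ 2) := by gcongr
      _ = 18 * (t * n ^ 2) * n ^ 2 := by ring
      _ = n ^ 2 := by rw [ht1]; ring
  nlinarith [mul_nonneg (sq_nonneg t) (mul_pos hA hB).le]

lemma gridPoint_eq_single {n : ℕ} (hn : 0 < n) (i : Fin 3) :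
    gridPoint n i = EuclideanSpace.single i 1 := by
  have hn' : (0 : ℝ) < n := by exact_mod_cast hn
  ext j
  fin_cases i <;> fin_cases j <;>
    simp [gridPoint, gridVec, tripleNormSq, Real.sqrt_sq hn'.le, hn'.ne']

/-- A correspondence between the `2`-sphere and the `k`-sphere: points of the `k`-sphere with a
large `i`-th coordinate are paired with `± gridPoint n i`, and points of the `2`-sphere with a large
`i`-th coordinate are paired with `±` the `i`-th basis vector. -/
def gridCorrespondence (n k : ℕ) : Set (Euc (2 + 1) × Euc (k + 1)) :=
  {z | ‖z.1‖ = 1 ∧ ‖z.2‖ = 1 ∧ ∃ (i : Fin (k + 1)) (s : ℝ), (s = 1 ∨ s = -1) ∧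
    ((z.1 = s • gridPoint n i ∧ 0 < s * z.2 i ∧ 1 ≤ (k + 1) * z.2 i ^ 2) ∨
      z.2 = s • EuclideanSpace.single i 1 ∧
        ∃ j : Fin 3, (j : ℕ) = i ∧ 0 < s * z.1 j ∧ 1 ≤ 3 * z.1 j ^ 2)}

lemma exists_large_coordinate {d : ℕ} {y : Euc (d + 1)} (hy : ‖y‖ = 1) :
    ∃ (i : Fin (d + 1)) (s : ℝ), (s = 1 ∨ s = -1) ∧ 0 < s * y i ∧ 1 ≤ (d + 1) * y i ^ 2 := by
  obtain ⟨i, hi⟩ : ∃ i, 1 ≤ ((d : ℝ) + 1) * y i ^ 2 := by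
    by_contra! h
    have h1 : ∑ i, y i ^ 2 = 1 := by
      have := EuclideanSpace.real_norm_sq_eq y
      rw [← this, hy, one_pow]
    have h2 : ∑ i, ((d : ℝ) + 1) * y i ^ 2 < ∑ _i : Fin (d + 1), (1 : ℝ) :=
      Finset.sum_lt_sum_of_nonempty Finset.univ_nonempty fun i _ => h i
    rw [← Finset.mul_sum, h1] at h2
    simp at h2
  have h0 : y i ≠ 0 := fun h0 => by norm_num [h0] at hi
  rcases h0.lt_or_gt with h | h
  · exact ⟨i, -1, Or.inr rfl, by linarith, hi⟩
  · exact ⟨i, 1, Or.inl rfl, by linarith, hi⟩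

lemma isCorrespondence_gridCorrespondence {n k : ℕ} (hk : 2 ≤ k) (hn : k + 1 ≤ n ^ 2) :
    IsCorrespondence (usphere 2) (usphere k) (gridCorrespondence n k) := by
  have hs : ∀ (d : ℕ) (s : ℝ) (x : Euc d), s = 1 ∨ s = -1 → ‖x‖ = 1 → ‖s • x‖ = 1 := by
    rintro d s x (rfl | rfl) hx <;> simp [hx]
  refine ⟨fun z hz => ⟨mem_usphere.2 hz.1, mem_usphere.2 hz.2.1⟩, fun u hu => ?_, fun y hy => ?_⟩
  · rw [mem_usphere] at hu
    obtain ⟨j, s, hs1, h0, h1⟩ := exists_large_coordinate hu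
    have hy : ‖s • (EuclideanSpace.single (Fin.castLE (by omega) j) 1 : Euc (k + 1))‖ = 1 :=
      hs _ _ _ hs1 (by simp)
    refine ⟨_, mem_usphere.2 hy, hu, hy, Fin.castLE (by omega) j, s, hs1,
      Or.inr ⟨rfl, j, by simp, h0, ?_⟩⟩
    push_cast at h1
    linarith
  · rw [mem_usphere] at hy
    obtain ⟨i, s, hs1, h0, h1⟩ := exists_large_coordinate hy
    have hu : ‖s • gridPoint n i‖ = 1 := hs _ _ _ hs1 (norm_gridPoint (i.2.trans_le hn))
    exact ⟨_, mem_usphere.2 hu, hu, hy, i, s, hs1, Or.inl ⟨rfl, h0, h1⟩⟩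

lemma neg_mem_gridCorrespondence {n k : ℕ} {z : Euc (2 + 1) × Euc (k + 1)}
    (hz : z ∈ gridCorrespondence n k) : -z ∈ gridCorrespondence n k := by
  obtain ⟨h1, h2, i, s, hs, h⟩ := hz
  refine ⟨by simpa using h1, by simpa using h2, i, -s, ?_, ?_⟩
  · rcases hs with rfl | rfl <;> simp
  · simpa using h

lemma sq_add_sq_le_one {d : ℕ} {y : Euc d} (hy : ‖y‖ = 1) {i j : Fin d} (hij : i ≠ j) :
    y i ^ 2 + y j ^ 2 ≤ 1 := by
  have h := EuclideanSpace.real_norm_sq_eq y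
  rw [hy, one_pow] at h
  rw [h, ← Finset.sum_pair hij (f := fun i => y i ^ 2)]
  exact Finset.sum_le_sum_of_subset_of_nonneg (Finset.subset_univ _) fun _ _ _ => sq_nonneg _

lemma inner_le_one_sub_coordinate_sub_sq {d : ℕ} {y y' : Euc d} (hy : ‖y‖ = 1) (hy' : ‖y'‖ = 1)
    (i : Fin d) : inner ℝ y y' ≤ 1 - (y i - y' i) ^ 2 / 2 := by
  rw [inner_eq_one_sub_norm_sub_sq hy hy']
  have := PiLp.norm_apply_le (y - y') i
  rw [PiLp.sub_apply, Real.norm_eq_abs] at this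
  have h2 := pow_le_pow_left₀ (abs_nonneg _) this 2
  rw [sq_abs] at h2
  linarith

/-- Points paired with nearby points by `gridCorrespondence` are not nearly antipodal. -/
lemma gridCorrespondence_inner {n k : ℕ} (hn : k + 1 ≤ n ^ 2)
    {z w : Euc (2 + 1) × Euc (k + 1)} (hz : z ∈ gridCorrespondence n k)
    (hw : w ∈ gridCorrespondence n k) (h : 1 - 1 / (18 * n ^ 2) < inner ℝ z.2 w.2) :
    -(1 - 1 / (18 * n ^ 2) : ℝ) ≤ inner ℝ z.1 w.1 := by
  have hn' : ((k : ℝ) + 1) ≤ n ^ 2 := by exact_mod_cast hn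
  have hn0 : 0 < n := Nat.pos_of_ne_zero (by rintro rfl; simp at hn)
  have hk0 : (0 : ℝ) < k + 1 := by positivity
  have hnr : (1 : ℝ) ≤ n := by exact_mod_cast hn0
  set t : ℝ := 1 / (18 * n ^ 2) with ht
  have htk : 18 * t ≤ 1 / (k + 1) := by
    have : 18 * t = 1 / n ^ 2 := by rw [ht]; field_simp
    rw [this]; gcongr
  have ht0 : 0 < t := by positivity
  have ht1 : t ≤ 1 / 18 := by
    rw [ht]; gcongr; nlinarith
  have hcoord : ∀ a : ℝ, 1 ≤ (k + 1) * a ^ 2 → 18 * t ≤ a ^ 2 := fun a ha =>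
    htk.trans (by rw [div_le_iff₀ hk0]; linarith)
  have hmixed : ∀ z w : Euc (2 + 1) × Euc (k + 1), ‖z.2‖ = 1 →
      1 - t < inner ℝ z.2 w.2 → ∀ (i i' : Fin (k + 1)) (s s' : ℝ), (s = 1 ∨ s = -1) →
      (s' = 1 ∨ s' = -1) → (z.1 = s • gridPoint n i ∧ 0 < s * z.2 i ∧ 1 ≤ (k + 1) * z.2 i ^ 2) →
      (w.2 = s' • EuclideanSpace.single i' 1 ∧
        ∃ j : Fin 3, (j : ℕ) = i' ∧ 0 < s' * w.1 j ∧ 1 ≤ 3 * w.1 j ^ 2) →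
      0 ≤ inner ℝ z.1 w.1 := by
    rintro z w hz h i i' s s' hs hs' ⟨hz1, hz2, hz3⟩ ⟨hw2, j, hj, hw3, -⟩
    rw [hw2, inner_smul_right, EuclideanSpace.inner_single_right] at h
    simp only [one_mul, conj_trivial] at h
    have hii : i = i' := by
      by_contra hne
      have h1 := sq_add_sq_le_one hz hne
      have h2 := hcoord _ hz3
      rcases hs' with rfl | rfl <;> nlinarith
    subst hii
    have hss : s = s' := by
      rcases hs with rfl | rfl <;> rcases hs' with rfl | rfl <;> first | rfl | linarith
    rw [hz1, inner_smul_left, ← hj, gridPoint_eq_single hn0, EuclideanSpace.inner_single_left]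
    simp only [conj_trivial, one_mul]
    rw [hss]
    exact hw3.le
  obtain ⟨hz1, hz2, i, s, hs, hzc⟩ := hz
  obtain ⟨hw1, hw2, i', s', hs', hwc⟩ := hw
  rcases hzc with hzc | hzc <;> rcases hwc with hwc | hwc
  · obtain ⟨e1, p1, q1⟩ := hzc
    obtain ⟨e2, p2, q2⟩ := hwc
    rw [e1, e2, inner_smul_left, inner_smul_right]
    simp only [conj_trivial]
    by_cases hii : i = i'
    · subst hii
      by_cases hss : s = s'
      · rw [hss, real_inner_self_eq_norm_sq, norm_gridPoint (i.2.trans_le hn)]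
        rcases hs' with rfl | rfl <;> norm_num <;> linarith
      · exfalso
        have h1 := inner_le_one_sub_coordinate_sub_sq hz2 hw2 i
        have h2 := hcoord _ q1
        have h3 : z.2 i * w.2 i ≤ 0 := by
          rcases hs with rfl | rfl <;> rcases hs' with rfl | rfl
          · exact absurd rfl hss
          · nlinarith
          · nlinarith
          · exact absurd rfl hss
        nlinarith [sq_nonneg (w.2 i)]
    · have h1 := abs_le.1 (abs_inner_gridPoint_le (i.2.trans_le hn) (i'.2.trans_le hn)
        fun h => hii (Fin.ext h))
      rcases hs with rfl | rfl <;> rcases hs' with rfl | rfl <;> linarith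
  · linarith [hmixed z w hz2 h i i' s s' hs hs' hzc hwc]
  · rw [real_inner_comm] at h ⊢
    linarith [hmixed w z hw2 h i' i s' s hs' hs hwc hzc]
  · obtain ⟨e1, j, hj, p1, q1⟩ := hzc
    obtain ⟨e2, j', hj', p2, q2⟩ := hwc
    rw [e1, e2, inner_smul_left, inner_smul_right, EuclideanSpace.inner_single_left] at h
    simp only [conj_trivial, one_mul, PiLp.single_apply] at h
    have hii : i = i' := by
      by_contra hne
      rw [if_neg hne] at h
      linarith
    subst hii
    rw [if_pos rfl] at h
    have hjj : j = j' := Fin.ext (hj.trans hj'.symm)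
    subst hjj
    have hss : s = s' := by
      rcases hs with rfl | rfl <;> rcases hs' with rfl | rfl <;> first | rfl | linarith
    subst hss
    have hprod : 0 < z.1 j * w.1 j := by
      rcases hs with rfl | rfl <;> nlinarith
    have h2 := inner_le_one_sub_coordinate_sub_sq (y := z.1) (y' := -w.1) hz1 (by rwa [norm_neg]) j
    rw [inner_neg_right, PiLp.neg_apply] at h2
    nlinarith

lemma sub_le_of_inner {d₁ d₂ : ℕ} {u u' : Euc d₁} {y y' : Euc d₂} {η : ℝ} (hη : 0 ≤ η)
    (hηpi : η ≤ π) (h : Real.cos η < inner ℝ y y' → -Real.cos η ≤ inner ℝ u u') :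
    geoDist u u' - geoDist y y' ≤ π - η := by
  by_cases hy : Real.cos η < inner ℝ y y'
  · have h1 := Real.arccos_le_arccos (h hy)
    rw [Real.arccos_neg, Real.arccos_cos hη hηpi] at h1
    have h2 := geoDist_nonneg y y'
    rw [geoDist]; linarith
  · have h1 := Real.arccos_le_arccos (not_lt.1 hy)
    rw [Real.arccos_cos hη hηpi] at h1
    have h2 := geoDist_le_pi u u'
    rw [geoDist] at h2 ⊢
    rw [geoDist]; linarith

theorem distortion_gridCorrespondence_le {n k : ℕ} (hn : k + 1 ≤ n ^ 2) :
    distortion (gridCorrespondence n k) ≤ π - 1 / (3 * n) := by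
  have hn0 : 0 < n := Nat.pos_of_ne_zero (by rintro rfl; simp at hn)
  have hnr : (1 : ℝ) ≤ n := by exact_mod_cast hn0
  have hη : (1 : ℝ) / (3 * n) ≤ 1 := by
    rw [div_le_one (by positivity)]; linarith
  have hpi := Real.pi_gt_three
  have hcos : (1 - 1 / (18 * n ^ 2) : ℝ) ≤ Real.cos (1 / (3 * n)) := by
    refine le_trans (le_of_eq ?_) (Real.one_sub_sq_div_two_le_cos)
    field_simp; ring
  have key : ∀ z ∈ gridCorrespondence n k, ∀ w ∈ gridCorrespondence n k,
      geoDist z.1 w.1 - geoDist z.2 w.2 ≤ π - 1 / (3 * n) := fun z hz w hw =>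
    sub_le_of_inner (by positivity) (by linarith) fun h => by
      linarith [gridCorrespondence_inner hn hz hw (hcos.trans_lt h)]
  refine Real.sSup_le ?_ (by linarith)
  rintro t ⟨z, hz, w, hw, rfl⟩
  rw [abs_le]
  refine ⟨?_, key z hz w hw⟩
  have h1 := key z hz (-w) (neg_mem_gridCorrespondence hw)
  rw [Prod.fst_neg, Prod.snd_neg, geoDist_neg_right, geoDist_neg_right] at h1
  linarith

/-- There exist constants c₁, c₂ > 0 such that for all k ≥ 3,
c₁/√k ≤ π − 2 d_GH(S^2, S^k) ≤ c₂/√k. -/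
theorem two_dGH_S2_theta :
    ∃ c₁ c₂ : ℝ, 0 < c₁ ∧ 0 < c₂ ∧ ∀ k : ℕ, 3 ≤ k →
      c₁ / Real.sqrt k ≤ π - twoGH 2 k ∧ π - twoGH 2 k ≤ c₂ / Real.sqrt k := by
  refine ⟨1 / 6, 21 * π, by norm_num, by positivity, fun k hk => ⟨?_, ?_⟩⟩
  · have hk' : (1 : ℝ) ≤ k := by exact_mod_cast (by omega : 1 ≤ k)
    have hn : k + 1 ≤ (Nat.sqrt k + 1) ^ 2 := Nat.lt_succ_sqrt' k
    have h1 := (twoGH_le_distortion (isCorrespondence_gridCorrespondence (by omega) hn)).trans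
      (distortion_gridCorrespondence_le hn)
    have h2 : ((Nat.sqrt k + 1 : ℕ) : ℝ) ≤ 2 * Real.sqrt k := by
      have h3 : (1 : ℝ) ≤ Real.sqrt k := Real.one_le_sqrt.2 hk'
      have h4 := Real.nat_sqrt_le_real_sqrt (a := k)
      push_cast; linarith
    have h5 : 1 / 6 / Real.sqrt k ≤ 1 / (3 * ((Nat.sqrt k + 1 : ℕ) : ℝ)) := by
      rw [div_div]
      exact one_div_le_one_div_of_le (by positivity) (by linarith)
    linarith
  · have h1 := le_twoGH fun R hR => le_distortion (k := k) (by omega) hR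
    linarith
end
end

section
/- Let k ≥ 1 and let Q = {±e_1, …, ±e_{k+1}} ⊆ S^k be the standard basis vectors and their negatives. Then vdiam_{S^k}(Q) = arccos(−(k−1)/(k+1)) and sep_{S^k}(Q) = π/2. -/
open Real

noncomputable section

/-- The separation of a set P: the infimum of geodesic distances between distinct points. -/
def sepS {d : ℕ} (P : Set (Euc d)) : ℝ :=
  sInf {t | ∃ p ∈ P, ∃ q ∈ P, p ≠ q ∧ t = geoDist p q}

/-- The diameter of a set with respect to the geodesic metric. -/
def geoDiam {d : ℕ} (A : Set (Euc d)) : ℝ :=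
  sSup {t | ∃ x ∈ A, ∃ y ∈ A, t = geoDist x y}

/-- The Voronoi cell of p with respect to the point set P, within the ambient set S:
all x ∈ S at least as close (geodesically) to p as to every point of P. -/
def vcell {d : ℕ} (S P : Set (Euc d)) (p : Euc d) : Set (Euc d) :=
  {x ∈ S | ∀ q ∈ P, geoDist x p ≤ geoDist x q}

/-- The Voronoi diameter of the point set P in the ambient set S:
the supremum of the diameters of the Voronoi cells of the points of P. -/
def vdiam {d : ℕ} (S P : Set (Euc d)) : ℝ :=
  sSup {t | ∃ p ∈ P, t = geoDiam (vcell S P p)}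

/-- The vertex set of the cross-polytope in S^k: the standard basis vectors
and their negatives. -/
def crossQ (k : ℕ) : Set (Euc (k+1)) :=
  {x | ∃ i : Fin (k+1), x = EuclideanSpace.single i (1:ℝ) ∨
    x = - EuclideanSpace.single i (1:ℝ)}

/-- A point of the cross-polytope is a unit vector. -/
lemma norm_eq_one_of_mem_crossQ {k : ℕ} {p : Euc (k+1)} (hp : p ∈ crossQ k) : ‖p‖ = 1 := by
  rcases hp with ⟨i, rfl | rfl⟩ <;> simp

lemma norm_eq_one_of_mem_usphere {k : ℕ} {x : Euc (k+1)} (hx : x ∈ usphere k) : ‖x‖ = 1 := by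
  have h : inner ℝ x x = (1 : ℝ) := hx
  rw [real_inner_self_eq_norm_sq] at h
  nlinarith [norm_nonneg x]

/-- The Voronoi cell of `p` consists of the points whose inner product with `p` dominates the
absolute values of all coordinates. -/
lemma mem_vcell_crossQ_iff {k : ℕ} {p x : Euc (k+1)} (hp : p ∈ crossQ k) (hx : x ∈ usphere k) :
    x ∈ vcell (usphere k) (crossQ k) p ↔ ∀ j, |x j| ≤ inner ℝ x p := by
  have hmem (q : Euc (k+1)) (hq : q ∈ crossQ k) : inner ℝ x q ∈ Set.Icc (-1 : ℝ) 1 := by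
    have h := abs_real_inner_le_norm x q
    rw [norm_eq_one_of_mem_crossQ hq, norm_eq_one_of_mem_usphere hx, mul_one] at h
    exact abs_le.mp h
  have hdist (q : Euc (k+1)) (hq : q ∈ crossQ k) :
      geoDist x p ≤ geoDist x q ↔ inner ℝ x q ≤ (inner ℝ x p : ℝ) :=
    Real.strictAntiOn_arccos.le_iff_ge (hmem p hp) (hmem q hq)
  constructor
  · rintro ⟨-, h⟩ j
    have hpos := (hdist _ ⟨j, Or.inl rfl⟩).mp (h _ ⟨j, Or.inl rfl⟩)
    have hneg := (hdist _ ⟨j, Or.inr rfl⟩).mp (h _ ⟨j, Or.inr rfl⟩)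
    rw [inner_neg_right] at hneg
    simp only [EuclideanSpace.inner_single_right, one_mul, conj_trivial] at hpos hneg
    exact abs_le'.mpr ⟨hpos, hneg⟩
  · refine fun h => ⟨hx, fun q hq => (hdist q hq).mpr ?_⟩
    rcases hq with ⟨j, rfl | rfl⟩
    · simpa [EuclideanSpace.inner_single_right] using (le_abs_self _).trans (h j)
    · rw [inner_neg_right]
      simpa [EuclideanSpace.inner_single_right] using (neg_le_abs _).trans (h j)

lemma inv_sqrt_le_inner_of_mem_vcell {k : ℕ} {p x : Euc (k+1)} (hp : p ∈ crossQ k)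
    (hx : x ∈ vcell (usphere k) (crossQ k) p) : (√((k : ℝ) + 1))⁻¹ ≤ inner ℝ x p := by
  have h := (mem_vcell_crossQ_iff hp hx.1).mp hx
  have hnonneg : 0 ≤ (inner ℝ x p : ℝ) := (abs_nonneg _).trans (h 0)
  have hsum : ∑ j, x j ^ 2 = 1 := by
    rw [← EuclideanSpace.real_norm_sq_eq, norm_eq_one_of_mem_usphere hx.1, one_pow]
  have hle : ∑ j, x j ^ 2 ≤ ∑ _j : Fin (k+1), (inner ℝ x p : ℝ) ^ 2 :=
    Finset.sum_le_sum fun j _ => sq_le_sq.mpr ((h j).trans (le_abs_self _))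
  rw [hsum, Finset.sum_const, Finset.card_univ, Fintype.card_fin, nsmul_eq_mul] at hle
  push_cast at hle
  rw [← Real.sqrt_inv]
  refine Real.sqrt_le_iff.mpr ⟨hnonneg, ?_⟩
  rw [inv_le_iff_one_le_mul₀' (by positivity)]
  exact hle

lemma le_inner_of_mem_vcell {k : ℕ} {p x y : Euc (k+1)} (hp : p ∈ crossQ k)
    (hx : x ∈ vcell (usphere k) (crossQ k) p) (hy : y ∈ vcell (usphere k) (crossQ k) p) :
    -((k : ℝ) - 1) / ((k : ℝ) + 1) ≤ inner ℝ x y := by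
  have hxp := inv_sqrt_le_inner_of_mem_vcell hp hx
  have hyp := inv_sqrt_le_inner_of_mem_vcell hp hy
  have hcs := real_inner_le_norm (x + y) p
  rw [norm_eq_one_of_mem_crossQ hp, mul_one, inner_add_left] at hcs
  have hnorm := norm_add_sq_real x y
  rw [norm_eq_one_of_mem_usphere hx.1, norm_eq_one_of_mem_usphere hy.1] at hnorm
  have hr : 0 ≤ (√((k : ℝ) + 1))⁻¹ := by positivity
  have hr2 : (√((k : ℝ) + 1))⁻¹ ^ 2 = ((k : ℝ) + 1)⁻¹ := by
    rw [inv_pow, Real.sq_sqrt (by positivity)]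
  have heq : -((k : ℝ) - 1) / ((k : ℝ) + 1) = 2 * ((k : ℝ) + 1)⁻¹ - 1 := by
    field_simp
    ring
  rw [heq, ← hr2]
  nlinarith

/-- Some Voronoi cell contains two points at the extremal distance. -/
lemma exists_inner_eq_of_vcell (k : ℕ) :
    ∃ x ∈ vcell (usphere k) (crossQ k) (EuclideanSpace.single 0 1),
      ∃ y ∈ vcell (usphere k) (crossQ k) (EuclideanSpace.single 0 1),
        inner ℝ x y = -((k : ℝ) - 1) / ((k : ℝ) + 1) := by
  set r : ℝ := (√((k : ℝ) + 1))⁻¹ with hr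
  have hr0 : 0 ≤ r := by positivity
  have hr2 : ((k : ℝ) + 1) * r ^ 2 = 1 := by
    rw [hr, inv_pow, Real.sq_sqrt (by positivity), mul_inv_cancel₀ (by positivity)]
  have hp : (EuclideanSpace.single 0 1 : Euc (k+1)) ∈ crossQ k := ⟨0, Or.inl rfl⟩
  have hk : (k : ℝ) + 1 ≠ 0 := by positivity
  let x : Euc (k+1) := WithLp.toLp 2 fun _ => r
  let y : Euc (k+1) := WithLp.toLp 2 (Fin.cons r fun _ => -r)
  have hx : x ∈ usphere k := by
    change inner ℝ x x = (1 : ℝ)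
    simp only [x, PiLp.inner_apply, Fin.sum_univ_succ]
    simp
    linear_combination hr2
  have hy : y ∈ usphere k := by
    change inner ℝ y y = (1 : ℝ)
    simp only [y, PiLp.inner_apply, Fin.sum_univ_succ]
    simp
    linear_combination hr2
  refine ⟨x, (mem_vcell_crossQ_iff hp hx).mpr fun j => ?_,
    y, (mem_vcell_crossQ_iff hp hy).mpr fun j => ?_, ?_⟩
  · simp [x, EuclideanSpace.inner_single_right, abs_of_nonneg hr0]
  · refine Fin.cases ?_ (fun j => ?_) j <;>
      simp [y, EuclideanSpace.inner_single_right, abs_of_nonneg hr0]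
  · rw [eq_div_iff hk]
    simp only [x, y, PiLp.inner_apply, Fin.sum_univ_succ]
    simp
    linear_combination (1 - (k : ℝ)) * hr2

lemma inner_nonpos_of_mem_crossQ {k : ℕ} {p q : Euc (k+1)} (hp : p ∈ crossQ k)
    (hq : q ∈ crossQ k) (hpq : p ≠ q) : inner ℝ p q ≤ (0 : ℝ) := by
  rcases hp with ⟨i, rfl | rfl⟩ <;> rcases hq with ⟨j, rfl | rfl⟩ <;>
    rcases eq_or_ne i j with rfl | hij <;>
    simp_all [EuclideanSpace.inner_single_right, inner_neg_right, Ne.symm]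

lemma isGreatest_vdiam_crossQ (k : ℕ) :
    IsGreatest {t | ∃ p ∈ crossQ k, t = geoDiam (vcell (usphere k) (crossQ k) p)}
      (Real.arccos (-((k : ℝ) - 1) / ((k : ℝ) + 1))) := by
  have hub {p : Euc (k+1)} (hp : p ∈ crossQ k) :
      Real.arccos (-((k : ℝ) - 1) / ((k : ℝ) + 1)) ∈ upperBounds
        {t | ∃ x ∈ vcell (usphere k) (crossQ k) p, ∃ y ∈ vcell (usphere k) (crossQ k) p,
          t = geoDist x y} := by
    rintro _ ⟨x, hx, y, hy, rfl⟩
    exact Real.antitone_arccos (le_inner_of_mem_vcell hp hx hy)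
  constructor
  · obtain ⟨x, hx, y, hy, hxy⟩ := exists_inner_eq_of_vcell k
    have hp : (EuclideanSpace.single 0 1 : Euc (k+1)) ∈ crossQ k := ⟨0, Or.inl rfl⟩
    refine ⟨EuclideanSpace.single 0 1, hp, Eq.symm (IsGreatest.csSup_eq ?_)⟩
    exact ⟨⟨x, hx, y, hy, by rw [geoDist, hxy]⟩, hub hp⟩
  · rintro _ ⟨p, hp, rfl⟩
    exact Real.sSup_le (fun t ht => hub hp ht) (Real.arccos_nonneg _)

lemma isLeast_sepS_crossQ {k : ℕ} (hk : 1 ≤ k) :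
    IsLeast {t | ∃ p ∈ crossQ k, ∃ q ∈ crossQ k, p ≠ q ∧ t = geoDist p q} (π / 2) := by
  constructor
  · have h01 : (0 : Fin (k+1)) ≠ Fin.last k := by
      simp only [ne_eq, Fin.ext_iff, Fin.val_zero, Fin.val_last]
      omega
    have hinner : inner ℝ (EuclideanSpace.single 0 1 : Euc (k+1))
        (EuclideanSpace.single (Fin.last k) 1) = (0 : ℝ) := by
      simp [EuclideanSpace.inner_single_right, h01.symm]
    refine ⟨EuclideanSpace.single 0 1, ⟨0, Or.inl rfl⟩, EuclideanSpace.single (Fin.last k) 1,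
      ⟨Fin.last k, Or.inl rfl⟩, fun h => ?_, ?_⟩
    · rw [← h] at hinner
      simp at hinner
    · rw [geoDist, hinner, Real.arccos_zero]
  · rintro _ ⟨p, hp, q, hq, hpq, rfl⟩
    rw [← Real.arccos_zero]
    exact Real.antitone_arccos (inner_nonpos_of_mem_crossQ hp hq hpq)

/-- For k ≥ 1 and Q = {±e₁,…,±e_{k+1}} ⊆ S^k, the Voronoi diameter of Q equals
arccos(−(k−1)/(k+1)) and the separation of Q equals π/2. -/
theorem crossPolytope_vdiam_sep (k : ℕ) (hk : 1 ≤ k) :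
    vdiam (usphere k) (crossQ k) = Real.arccos (-((k : ℝ) - 1) / ((k : ℝ) + 1)) ∧
    sepS (crossQ k) = π / 2 := by
  exact ⟨(isGreatest_vdiam_crossQ k).csSup_eq, (isLeast_sepS_crossQ hk).csInf_eq⟩
end
end

section
/- Let k ≥ 3 be odd. The distortion of the correspondence ℛ_k = {(x, f_m(x)) ∈ S^k × S^1 : 1 ≤ m ≤ 2k+2, x ∈ 𝒢_m} equals (k−1)π/k, where a real number θ = f_m(x) is identified with the point (cos θ, sin θ) ∈ S^1. -/
open Real

noncomputable section

/-- The circle distance between two angles θ, φ ∈ ℝ: the representative of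
|θ − φ| modulo 2π lying in [0, π] (the geodesic distance in S¹ between
(cos θ, sin θ) and (cos φ, sin φ)). -/
def circleDist (θ φ : ℝ) : ℝ := Real.arccos (Real.cos (θ - φ))

/-- The coordinate index (0-based) of the cell 𝒢_m: the 1-based index m reduced
modulo k+1 to {1,…,k+1}, shifted to 0-based. -/
def gIdx (k m : ℕ) : Fin (k+1) := ⟨(m - 1) % (k + 1), Nat.mod_lt _ (Nat.succ_pos k)⟩

/-- The sign of the cell 𝒢_m: writing m − 1 = q(k+1) + r, the sign is (−1)^{r+q}.
For 1 ≤ m ≤ k+1 this is (−1)^{m+1}, and 𝒢_{m+k+1} = −𝒢_m. -/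
def gSign (k m : ℕ) : ℝ := (-1) ^ ((m - 1) % (k + 1) + (m - 1) / (k + 1))

/-- The cell 𝒢_m = (−1)^{m+1} G_{m mod (k+1)} ⊆ S^k, where G_i is the Voronoi cell
of the standard basis vector e_i with respect to {±e₁,…,±e_{k+1}}:
x ∈ 𝒢_m iff x ∈ S^k and the signed coordinate gSign·x_{gIdx} dominates all |x_j|. -/
def Gcal (k m : ℕ) : Set (Euc (k+1)) :=
  {x | x ∈ usphere k ∧ ∀ j, |x j| ≤ gSign k m * x (gIdx k m)}

/-- The function f_m : 𝒢_m → ℝ (an angle parametrizing S¹),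
f_m(x) = (m−1)π/(k+1) + (π/(2k(k+1)))·(x_1 + ⋯ + x_{m−1} − x_{m+1} − ⋯ − x_{k+1})/x_m,
coordinate subscripts taken modulo k+1 (as angles, i.e. modulo 2π, for m > k+1). -/
def fFun (k m : ℕ) (x : Euc (k+1)) : ℝ :=
  ((m : ℝ) - 1) * π / ((k : ℝ) + 1) + π / (2 * (k : ℝ) * ((k : ℝ) + 1)) *
    ((∑ j : Fin (k+1),
        (if (j : ℕ) < (m - 1) % (k + 1) then (1:ℝ)
         else if (j : ℕ) = (m - 1) % (k + 1) then 0 else -1) * x j) / x (gIdx k m))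

/-- Shifting the window of summation of an antiperiodic sequence past its first `p` terms
flips the sign of these terms. -/
lemma sum_window_antiperiodic {n : ℕ} {H : ℕ → ℝ} (hH : ∀ j, H (j + n) = -H j) (p : ℕ) :
    ∑ i ∈ Finset.range n, H (p + i)
      = ∑ i ∈ Finset.range n, H i - 2 * ∑ i ∈ Finset.range p, H i := by
  induction p with
  | zero => simp
  | succ p ih =>
    have h1 := Finset.sum_range_succ (fun i => H (p + i)) n
    have h2 := Finset.sum_range_succ' (fun i => H (p + i)) n
    have h3 : ∑ i ∈ Finset.range n, H (p + 1 + i) = ∑ i ∈ Finset.range n, H (p + (i + 1)) :=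
      Finset.sum_congr rfl fun i _ => by congr 1; ring
    rw [Finset.sum_range_succ, h3]
    have := hH p
    simp only [add_zero] at h2
    linarith

/-- The sum of a periodic sequence over a full period does not depend on the window. -/
lemma sum_window_periodic {n : ℕ} {H : ℕ → ℝ} (hH : ∀ j, H (j + n) = H j) (p : ℕ) :
    ∑ i ∈ Finset.range n, H (p + i) = ∑ i ∈ Finset.range n, H i := by
  induction p with
  | zero => simp
  | succ p ih =>
    have h1 := Finset.sum_range_succ (fun i => H (p + i)) n
    have h2 := Finset.sum_range_succ' (fun i => H (p + i)) n
    have h3 : ∑ i ∈ Finset.range n, H (p + 1 + i) = ∑ i ∈ Finset.range n, H (p + (i + 1)) :=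
      Finset.sum_congr rfl fun i _ => by congr 1; ring
    rw [h3]
    have := hH p
    simp only [add_zero] at h2
    linarith

/-- The antiperiodic extension, of antiperiod `k + 1`, of the coordinates of `x`. -/
def antiExt (k : ℕ) (x : Euc (k+1)) (j : ℕ) : ℝ :=
  (-1) ^ (j / (k + 1)) * x ⟨j % (k + 1), Nat.mod_lt _ (Nat.succ_pos k)⟩

lemma antiExt_add (k : ℕ) (x : Euc (k+1)) (j : ℕ) :
    antiExt k x (j + (k + 1)) = -antiExt k x j := by
  simp [antiExt, Nat.add_div_right, pow_succ]

lemma antiExt_of_lt {k : ℕ} (x : Euc (k+1)) {j : ℕ} (hj : j < k + 1) :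
    antiExt k x j = x ⟨j, hj⟩ := by
  simp [antiExt, Nat.div_eq_of_lt hj, Nat.mod_eq_of_lt hj]

lemma antiExt_eq_mod (k : ℕ) (x : Euc (k+1)) (j : ℕ) :
    antiExt k x j = (-1) ^ (j / (k + 1)) * antiExt k x (j % (k + 1)) := by
  rw [antiExt_of_lt x (Nat.mod_lt _ (Nat.succ_pos k)), antiExt]

lemma inner_eq_sum_antiExt (k : ℕ) (x y : Euc (k+1)) :
    @inner ℝ _ _ x y = ∑ i ∈ Finset.range (k + 1), antiExt k x i * antiExt k y i := by
  rw [← Fin.sum_univ_eq_sum_range (fun i => antiExt k x i * antiExt k y i), PiLp.inner_apply]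
  refine Finset.sum_congr rfl fun i _ => ?_
  rw [antiExt_of_lt x i.2, antiExt_of_lt y i.2]
  simp [mul_comm]

lemma sum_window_antiExt_mul (k r : ℕ) (x y : Euc (k+1)) :
    ∑ i ∈ Finset.range (k + 1), antiExt k x (r + i) * antiExt k y (r + i)
      = @inner ℝ _ _ x y := by
  rw [inner_eq_sum_antiExt]
  exact sum_window_periodic (H := fun i => antiExt k x i * antiExt k y i)
    (fun j => by simp only [antiExt_add]; ring) r

lemma neg_one_pow_mod_of_even {n : ℕ} (hn : Even n) (r : ℕ) :
    (-1 : ℝ) ^ (r % n) = (-1) ^ r := by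
  conv_rhs => rw [← Nat.mod_add_div r n, pow_add, pow_mul, hn.neg_one_pow, one_pow, mul_one]

lemma abs_antiExt_le_of_mem_Gcal {k : ℕ} (hodd : Odd k) {r : ℕ} {x : Euc (k+1)}
    (hx : x ∈ Gcal k (r + 1)) (i : ℕ) : |antiExt k x i| ≤ (-1) ^ r * antiExt k x r := by
  have h := hx.2 ⟨i % (k + 1), Nat.mod_lt _ (Nat.succ_pos k)⟩
  simp only [gSign, gIdx, Nat.add_sub_cancel, pow_add] at h
  rw [neg_one_pow_mod_of_even hodd.add_one] at h
  simpa [antiExt, abs_mul, mul_assoc] using h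

lemma fFun_eq_antiExt {k : ℕ} (r : ℕ) (x : Euc (k+1)) (h0 : antiExt k x r ≠ 0) :
    fFun k (r + 1) x = (r : ℝ) * π / ((k : ℝ) + 1) + π / (2 * (k : ℝ) * ((k : ℝ) + 1)) *
      (1 - (∑ i ∈ Finset.range (k + 1), antiExt k x (r + i)) / antiExt k x r) := by
  have hr : r % (k + 1) < k + 1 := Nat.mod_lt _ (Nat.succ_pos k)
  set s := r % (k + 1) with hs
  have hsgn : ((-1 : ℝ) ^ (r / (k + 1))) ≠ 0 := by positivity
  have hfirst : ∑ i ∈ Finset.range (k + 1), antiExt k x (r + i)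
      = (-1) ^ (r / (k + 1)) * ∑ i ∈ Finset.range (k + 1), antiExt k x (s + i) := by
    rw [Finset.mul_sum]
    refine Finset.sum_congr rfl fun i _ => ?_
    have h : r + i = (s + i) + (k + 1) * (r / (k + 1)) := by
      have := Nat.mod_add_div r (k + 1); omega
    rw [h]
    simp only [antiExt, Nat.add_mul_mod_self_left, Nat.add_mul_div_left _ _ (Nat.succ_pos k),
      pow_add]
    ring
  have hsum : (∑ j : Fin (k+1),
        (if (j : ℕ) < s then (1:ℝ) else if (j : ℕ) = s then 0 else -1) * x j)
      = antiExt k x s - ∑ i ∈ Finset.range (k + 1), antiExt k x (s + i) := by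
    rw [sum_window_antiperiodic (antiExt_add k x)]
    have h1 : ∑ i ∈ Finset.range s, antiExt k x i
        = ∑ i ∈ Finset.range (k + 1), if i < s then antiExt k x i else 0 := by
      rw [← Finset.sum_filter]
      congr 1
      ext i
      simp only [Finset.mem_range, Finset.mem_filter]
      omega
    have h2 : antiExt k x s
        = ∑ i ∈ Finset.range (k + 1), if i = s then antiExt k x i else 0 := by
      simp [hr]
    rw [h1, h2, Finset.mul_sum, ← Finset.sum_sub_distrib, ← Finset.sum_sub_distrib,
      ← Fin.sum_univ_eq_sum_range (fun i => (if i = s then antiExt k x i else 0) -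
        (antiExt k x i - 2 * if i < s then antiExt k x i else 0))]
    refine Finset.sum_congr rfl fun i _ => ?_
    rw [antiExt_of_lt x i.2]
    split_ifs <;> first | omega | (simp; try ring)
  have hx0 : x (gIdx k (r + 1)) = antiExt k x s := by
    rw [antiExt_of_lt x hr]; simp [gIdx, hs]
  have hs0 : antiExt k x s ≠ 0 := fun h => h0 (by rw [antiExt_eq_mod, ← hs, h, mul_zero])
  rw [fFun, hx0, hfirst, antiExt_eq_mod k x r, ← hs, mul_div_mul_left _ _ hsgn]
  simp only [Nat.add_sub_cancel, ← hs, hsum, sub_div, div_self hs0]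
  push_cast
  ring

lemma arccos_cos_le_abs (t : ℝ) : Real.arccos (Real.cos t) ≤ |t| := by
  rcases le_total |t| π with h | h
  · rw [← Real.cos_abs, Real.arccos_cos (abs_nonneg t) h]
  · exact (Real.arccos_le_pi _).trans h

/-- The geodesic distance on the sphere is at least the Euclidean one. -/
lemma sum_sq_sub_le_arccos_sq {n : ℕ} {u v : ℕ → ℝ}
    (hu : ∑ i ∈ Finset.range n, u i * u i = 1) (hv : ∑ i ∈ Finset.range n, v i * v i = 1) :
    ∑ i ∈ Finset.range n, (u i - v i) ^ 2
      ≤ (Real.arccos (∑ i ∈ Finset.range n, u i * v i)) ^ 2 := by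
  set t := ∑ i ∈ Finset.range n, u i * v i with ht
  have h1 : ∑ i ∈ Finset.range n, (u i - v i) ^ 2 = 2 - 2 * t := by
    have : ∀ i, (u i - v i) ^ 2 = u i * u i + v i * v i - 2 * (u i * v i) := fun i => by ring
    simp only [this, Finset.sum_add_distrib, Finset.sum_sub_distrib, ← Finset.mul_sum, hu, hv, ← ht]
    ring
  have h2 : t ^ 2 ≤ 1 := by
    have h := Finset.sum_mul_sq_le_sq_mul_sq (Finset.range n) u v
    simp only [pow_two (u _), pow_two (v _), hu, hv] at h
    simpa [← ht] using h
  have ht1 : -1 ≤ t ∧ t ≤ 1 := abs_le.mp ((sq_le_one_iff_abs_le_one t).mp h2)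
  have h3 := Real.one_sub_sq_div_two_le_cos (x := Real.arccos t)
  rw [Real.cos_arccos ht1.1 ht1.2] at h3
  rw [h1]
  linarith

lemma one_le_mul_sq_of_dominates {n : ℕ} {u : ℕ → ℝ} {M : ℝ}
    (hu : ∑ i ∈ Finset.range n, u i * u i = 1) (hM : ∀ i, |u i| ≤ M) : 1 ≤ n * M ^ 2 := by
  rw [← hu]
  calc ∑ i ∈ Finset.range n, u i * u i ≤ ∑ _i ∈ Finset.range n, M ^ 2 := by
        refine Finset.sum_le_sum fun i _ => ?_
        rw [← abs_mul_abs_self, ← pow_two]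
        exact pow_le_pow_left₀ (abs_nonneg _) (hM i) 2
    _ = n * M ^ 2 := by simp

/-- Two unit vectors dominated by opposite values of the same coordinate make an angle at least
`π / k`. -/
lemma pi_div_le_arccos_of_opposite {k : ℕ} (hk : 3 ≤ k) {u v : ℕ → ℝ}
    (hu : ∑ i ∈ Finset.range (k + 1), u i * u i = 1)
    (hv : ∑ i ∈ Finset.range (k + 1), v i * v i = 1)
    (hu0 : ∀ i, |u i| ≤ u 0) (hv0 : ∀ i, |v i| ≤ -v 0) :
    π / k ≤ Real.arccos (∑ i ∈ Finset.range (k + 1), u i * v i) := by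
  have hk' : (3 : ℝ) ≤ k := by exact_mod_cast hk
  have hMu := one_le_mul_sq_of_dominates hu hu0
  have hMv := one_le_mul_sq_of_dominates hv hv0
  push_cast at hMu hMv
  rw [Finset.sum_range_succ'] at hu hv ⊢
  have hcs := Finset.sum_mul_sq_le_sq_mul_sq (Finset.range k) (fun i => u (i + 1))
    (fun i => v (i + 1))
  set t := ∑ i ∈ Finset.range k, u (i + 1) * v (i + 1)
  simp only [pow_two (u _), pow_two (v _)] at hcs
  have hU0 : 0 ≤ u 0 := (abs_nonneg _).trans (hu0 0)
  have hV0 : 0 ≤ -v 0 := (abs_nonneg _).trans (hv0 0)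
  have hn : (0 : ℝ) < k + 1 := by positivity
  have hle : t + u 0 * v 0 ≤ (k - 1) / (k + 1) := by
    have hUsq : 1 / ((k : ℝ) + 1) ≤ u 0 ^ 2 := by rw [div_le_iff₀ hn]; linarith
    have hVsq : 1 / ((k : ℝ) + 1) ≤ (-v 0) ^ 2 := by rw [div_le_iff₀ hn]; linarith
    have hprod : 1 / ((k : ℝ) + 1) ≤ u 0 * -v 0 := by
      refine le_of_sq_le_sq ?_ (mul_nonneg hU0 hV0)
      rw [mul_pow, pow_two (1 / _)]
      exact mul_le_mul hUsq hVsq (by positivity) (by positivity)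
    have ht : t ≤ k / (k + 1) := by
      refine le_of_sq_le_sq (hcs.trans ?_) (by positivity)
      have e : (k : ℝ) / (k + 1) = 1 - 1 / (k + 1) := by field_simp; ring
      rw [pow_two, e]
      refine mul_le_mul (by nlinarith) (by nlinarith)
        (Finset.sum_nonneg fun i _ => mul_self_nonneg _) ?_
      rw [← e]; positivity
    have e : ((k : ℝ) - 1) / (k + 1) = k / (k + 1) - 1 / (k + 1) := by ring
    rw [e]; linarith
  have hcos : ((k : ℝ) - 1) / (k + 1) ≤ Real.cos (π / k) := by
    rcases hk.eq_or_lt with rfl | h4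
    · norm_num [Real.cos_pi_div_three]
    · have h4' : (4 : ℝ) ≤ k := by exact_mod_cast h4
      refine le_trans ?_ (Real.one_sub_sq_div_two_le_cos (x := π / k))
      have hpi : π ^ 2 ≤ 10 := by nlinarith [Real.pi_lt_d2, Real.pi_pos]
      rw [div_pow, div_le_iff₀ hn]
      have : π ^ 2 / (k : ℝ) ^ 2 * (k + 1) ≤ 4 := by
        rw [div_mul_eq_mul_div, div_le_iff₀ (by positivity)]
        nlinarith
      nlinarith
  have hpk : π / k ≤ π := div_le_self Real.pi_pos.le (by linarith)
  rw [← Real.arccos_cos (x := π / k) (by positivity) hpk]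
  exact Real.arccos_le_arccos (hle.trans hcos)

lemma abs_one_sub_window_div_le {k : ℕ} {w : ℕ → ℝ} (hw0 : w 0 ≠ 0)
    (hw : ∀ i, |w i| ≤ |w 0|) :
    |1 - (∑ i ∈ Finset.range (k + 1), w i) / w 0| ≤ k := by
  rw [Finset.sum_range_succ', add_div, div_self hw0]
  have h : ∑ i ∈ Finset.range k, |w (i + 1) / w 0| ≤ ∑ _i ∈ Finset.range k, (1 : ℝ) :=
    Finset.sum_le_sum fun i _ => by
      rw [abs_div]; exact div_le_one_of_le₀ (hw _) (abs_nonneg _)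
  rw [sub_add_cancel_right, abs_neg, Finset.sum_div]
  refine (Finset.abs_sum_le_sum_abs _ _).trans (h.trans ?_)
  simp

/-- Normalising by the dominating coordinate is Lipschitz in each coordinate. -/
lemma sub_div_dominating_le {n : ℕ} {u v : ℕ → ℝ} {M N d : ℝ}
    (hM0 : 0 < M) (hN0 : 0 < N) (hN : 1 ≤ n * N ^ 2) (hu : ∀ i, |u i| ≤ M)
    (hd : ∀ i < n, |u i - v i| ≤ d) (hMN : |M - N| ≤ d) {i : ℕ} (hi : i < n) :
    u i / M - v i / N ≤ 2 * Real.sqrt n * d := by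
  have hd0 : 0 ≤ d := (abs_nonneg _).trans hMN
  have h1 : u i / M - v i / N = ((u i - v i) + u i / M * (N - M)) / N := by
    field_simp; ring
  have h2 : u i / M * (N - M) ≤ d := by
    refine (le_abs_self _).trans ?_
    rw [abs_mul, abs_div, abs_of_pos hM0, abs_sub_comm N M]
    have : |u i| / M ≤ 1 := div_le_one_of_le₀ (hu i) hM0.le
    nlinarith [abs_nonneg (M - N)]
  have h3 : 1 ≤ Real.sqrt n * N := by
    refine le_of_sq_le_sq ?_ (by positivity)
    rw [mul_pow, Real.sq_sqrt (Nat.cast_nonneg n)]; simpa using hN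
  rw [h1, div_le_iff₀ hN0]
  have h4 := (le_abs_self _).trans (hd i hi)
  nlinarith

/-- If `v p = -N`, `N` dominates `v`, and `M ≤ N` bounds `-u p`, then the sum of the differences of
`u` and `v` normalised by `M` and `N` is controlled by their Euclidean distance. -/
lemma sum_normalised_sub_le {k : ℕ} {u v : ℕ → ℝ} {M N d : ℝ} {p : ℕ} (hp : p < k + 1)
    (hM0 : 0 < M) (hMN : M ≤ N) (hM : 1 ≤ ((k : ℝ) + 1) * M ^ 2)
    (hup : -u p ≤ M) (hvp : v p = -N) (hv : ∀ i, |v i| ≤ N)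
    (hd0 : 0 ≤ d) (hd : ∑ i ∈ Finset.range (k + 1), (u i - v i) ^ 2 ≤ d ^ 2) (hk : 1 ≤ k) :
    ∑ i ∈ Finset.range (k + 1), (u i / M - v i / N) ≤ ((k : ℝ) + 1) * Real.sqrt k * d := by
  have hN0 : 0 < N := hM0.trans_le hMN
  have hk' : (1 : ℝ) ≤ k := by exact_mod_cast hk
  have hpm : p ∈ Finset.range (k + 1) := Finset.mem_range.mpr hp
  have hcard : ((Finset.range (k + 1)).erase p).card = k := by
    rw [Finset.card_erase_of_mem hpm]; simp
  set E := (Finset.range (k + 1)).erase p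
  have hsplit : ∀ g : ℕ → ℝ, ∑ i ∈ Finset.range (k + 1), g i = g p + ∑ i ∈ E, g i :=
    fun g => (Finset.add_sum_erase _ g hpm).symm
  rw [hsplit] at hd ⊢
  set a := u p - v p with ha
  set D := ∑ i ∈ E, (u i - v i) with hD
  have hD2 : D ^ 2 ≤ k * ∑ i ∈ E, (u i - v i) ^ 2 := by
    have := sq_sum_le_card_mul_sum_sq (s := E) (f := fun i => u i - v i)
    rwa [hcard] at this
  have hV : ∑ i ∈ E, v i ≤ k * N := by
    calc ∑ i ∈ E, v i ≤ ∑ _i ∈ E, N :=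
          Finset.sum_le_sum fun i _ => (le_abs_self _).trans (hv i)
      _ = k * N := by simp [hcard]
  have hid : u p / M - v p / N + ∑ i ∈ E, (u i / M - v i / N)
      = (a + D + (v p + ∑ i ∈ E, v i) * ((N - M) / N)) / M := by
    have : ∑ i ∈ E, (u i / M - v i / N) = (∑ i ∈ E, u i) / M - (∑ i ∈ E, v i) / N := by
      rw [Finset.sum_sub_distrib, Finset.sum_div, Finset.sum_div]
    rw [this, hD, Finset.sum_sub_distrib, ha]
    field_simp
    ring
  have hNMa : N - M ≤ a := by rw [ha, hvp]; linarith
  have hprod : (v p + ∑ i ∈ E, v i) * ((N - M) / N) ≤ (k - 1) * a := by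
    have h1 : v p + ∑ i ∈ E, v i ≤ (k - 1) * N := by rw [hvp]; linarith
    have h2 : 0 ≤ (N - M) / N := div_nonneg (by linarith) hN0.le
    calc _ ≤ ((k - 1) * N) * ((N - M) / N) := mul_le_mul_of_nonneg_right h1 h2
      _ = (k - 1) * (N - M) := by field_simp
      _ ≤ _ := mul_le_mul_of_nonneg_left hNMa (by linarith)
  have hnum : a + D + (v p + ∑ i ∈ E, v i) * ((N - M) / N) ≤ k * a + D := by linarith
  have hsq : (k * a + D) ^ 2 ≤ (k * (k + 1)) * d ^ 2 := by
    have h1 : (k * a + D) ^ 2 ≤ (k + 1) * (k * a ^ 2 + D ^ 2) := by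
      nlinarith [mul_nonneg (Nat.cast_nonneg (α := ℝ) k) (sq_nonneg (a - D))]
    have h2 : k * a ^ 2 + D ^ 2 ≤ k * d ^ 2 := by nlinarith
    nlinarith
  rw [hid, div_le_iff₀ hM0]
  refine hnum.trans (le_of_sq_le_sq ?_ (by positivity))
  have hexp : (((k : ℝ) + 1) * Real.sqrt k * d * M) ^ 2
      = (k * (k + 1)) * d ^ 2 * ((k + 1) * M ^ 2) := by
    rw [mul_pow, mul_pow, mul_pow, Real.sq_sqrt (Nat.cast_nonneg k)]; ring
  rw [hexp]
  exact hsq.trans (le_mul_of_one_le_right (by positivity) hM)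

/-- The angle bound for cells at distance `k - 1`. -/
lemma window_div_sub_le_of_even {q : ℕ} {u v : ℕ → ℝ} {d : ℝ}
    (hanti : ∀ j, v (j + (q + 2)) = -v j)
    (hu0 : ∀ i, |u i| ≤ u 0) (hv0 : ∀ i, |v i| ≤ v q)
    (hu : ∑ i ∈ Finset.range (q + 2), u i * u i = 1)
    (hv : ∑ i ∈ Finset.range (q + 2), v i * v i = 1)
    (hd0 : 0 ≤ d) (hd : ∑ i ∈ Finset.range (q + 2), (u i - v i) ^ 2 ≤ d ^ 2) :
    (∑ i ∈ Finset.range (q + 2), u i) / u 0 - (∑ i ∈ Finset.range (q + 2), v (q + i)) / v q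
      ≤ 2 * q + 2 * Real.sqrt (q + 2) * d := by
  have hMu := one_le_mul_sq_of_dominates hu hu0
  have hMv := one_le_mul_sq_of_dominates hv hv0
  have hM0 : 0 < u 0 := ((abs_nonneg _).trans (hu0 0)).lt_of_ne fun h => by
    rw [← h] at hMu; norm_num at hMu
  have hN0 : 0 < v q := ((abs_nonneg _).trans (hv0 0)).lt_of_ne fun h => by
    rw [← h] at hMv; norm_num at hMv
  have hdi : ∀ i < q + 2, |u i - v i| ≤ d := fun i hi => by
    refine abs_le_of_sq_le_sq (le_trans ?_ hd) hd0
    exact Finset.single_le_sum (f := fun i => (u i - v i) ^ 2) (fun i _ => sq_nonneg _)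
      (Finset.mem_range.mpr hi)
  have hMN : |u 0 - v q| ≤ d := by
    have h1 := abs_le.mp (hdi 0 (by omega))
    have h2 := abs_le.mp (hdi q (by omega))
    have h3 := (le_abs_self _).trans (hv0 0)
    have h4 := (le_abs_self _).trans (hu0 q)
    exact abs_le.mpr ⟨by linarith, by linarith⟩
  have hlast := sub_div_dominating_le hM0 hN0 hMv hu0 hdi hMN (i := q + 1) (by omega)
  push_cast at hlast
  have hsu : (∑ i ∈ Finset.range q, u i) / u 0 ≤ q := by
    rw [div_le_iff₀ hM0]
    calc _ ≤ ∑ _i ∈ Finset.range q, u 0 :=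
          Finset.sum_le_sum fun i _ => (le_abs_self _).trans (hu0 i)
      _ = _ := by simp
  have hsv : (∑ i ∈ Finset.range q, v i) / v q ≤ q := by
    rw [div_le_iff₀ hN0]
    calc _ ≤ ∑ _i ∈ Finset.range q, v q :=
          Finset.sum_le_sum fun i _ => (le_abs_self _).trans (hv0 i)
      _ = _ := by simp
  have huq : u q / u 0 ≤ 1 := (div_le_one hM0).mpr ((le_abs_self _).trans (hu0 q))
  rw [sum_window_antiperiodic hanti]
  simp only [Finset.sum_range_succ, add_div, sub_div, div_self hN0.ne', mul_div_assoc]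
  linarith

/-- The angle bound for cells at distance `k`. -/
lemma window_div_sub_le_of_odd {k : ℕ} (hk : 1 ≤ k) {u v : ℕ → ℝ} {d : ℝ}
    (hanti : ∀ j, v (j + (k + 1)) = -v j)
    (hu0 : ∀ i, |u i| ≤ u 0) (hv0 : ∀ i, |v i| ≤ -v k)
    (hu : ∑ i ∈ Finset.range (k + 1), u i * u i = 1)
    (hv : ∑ i ∈ Finset.range (k + 1), v i * v i = 1)
    (hd0 : 0 ≤ d) (hd : ∑ i ∈ Finset.range (k + 1), (u i - v i) ^ 2 ≤ d ^ 2) :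
    (∑ i ∈ Finset.range (k + 1), u i) / u 0 - (∑ i ∈ Finset.range (k + 1), v (k + i)) / v k
      ≤ -2 + (k + 1) * Real.sqrt k * d := by
  have hMu := one_le_mul_sq_of_dominates hu hu0
  have hMv := one_le_mul_sq_of_dominates hv hv0
  have hM0 : 0 < u 0 := ((abs_nonneg _).trans (hu0 0)).lt_of_ne fun h => by
    rw [← h] at hMu; norm_num at hMu
  have hN0 : 0 < -v k := ((abs_nonneg _).trans (hv0 0)).lt_of_ne fun h => by
    rw [← h] at hMv; norm_num at hMv
  push_cast at hMu hMv
  have hT : ∑ i ∈ Finset.range (k + 1), (u i / u 0 - v i / -v k)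
      ≤ ((k : ℝ) + 1) * Real.sqrt k * d := by
    rcases le_total (u 0) (-v k) with h | h
    · exact sum_normalised_sub_le (p := k) (by omega) hM0 h hMu ((neg_le_abs _).trans (hu0 k))
        (by ring) hv0 hd0 hd hk
    · have := sum_normalised_sub_le (u := fun i => -v i) (v := fun i => -u i) (p := 0) (by omega)
        hN0 h hMv (by simpa using (le_abs_self _).trans (hv0 0)) rfl (by simpa using hu0) hd0
        (le_trans (le_of_eq (Finset.sum_congr rfl fun i _ => by ring)) hd) hk
      refine le_trans (le_of_eq (Finset.sum_congr rfl fun i _ => by ring)) this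
  have hvk : v k ≠ 0 := (neg_pos.mp hN0).ne
  rw [sum_window_antiperiodic hanti]
  have hV : (∑ i ∈ Finset.range (k + 1), v i - 2 * ∑ i ∈ Finset.range k, v i) / v k
      = 2 + (∑ i ∈ Finset.range (k + 1), v i) / -v k := by
    rw [Finset.sum_range_succ]
    field_simp
    ring
  rw [hV]
  rw [Finset.sum_sub_distrib, ← Finset.sum_div, ← Finset.sum_div] at hT
  linarith

lemma pi_div_mul_sqrt_add_two_le {q : ℝ} (hq : 2 ≤ q) :
    π / (2 * (q + 1) * (q + 1 + 1)) * (2 * Real.sqrt (q + 2)) ≤ 1 := by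
  have hs2 : (2 : ℝ) ≤ Real.sqrt (q + 2) := Real.le_sqrt_of_sq_le (by linarith)
  have hsq : Real.sqrt (q + 2) * Real.sqrt (q + 2) = q + 2 := Real.mul_self_sqrt (by linarith)
  have h3 : π * Real.sqrt (q + 2) ≤ 4 * Real.sqrt (q + 2) :=
    mul_le_mul_of_nonneg_right Real.pi_le_four (by linarith)
  rw [div_mul_eq_mul_div, div_le_one (by positivity)]
  nlinarith

lemma pi_div_mul_sqrt_le {q : ℝ} (hq : 3 ≤ q) :
    π / (2 * q * (q + 1)) * ((q + 1) * Real.sqrt q) ≤ 1 := by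
  have hs2 : (1.6 : ℝ) ≤ Real.sqrt q := Real.le_sqrt_of_sq_le (by norm_num; linarith)
  have hsq : Real.sqrt q * Real.sqrt q = q := Real.mul_self_sqrt (by linarith)
  have h3 : π * Real.sqrt q ≤ 2 * q := by nlinarith [Real.pi_lt_d2]
  rw [div_mul_eq_mul_div, div_le_one (by positivity)]
  nlinarith

/-- The one-sided distortion bound in terms of antiperiodic coordinate sequences dominated at the
positions `0` and `p`. -/
lemma arccos_cos_angle_le {k : ℕ} (hk : 3 ≤ k) (hodd : Odd k) {u v : ℕ → ℝ} {p : ℕ}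
    (hp : p ≤ k + 1) (hanti : ∀ j, v (j + (k + 1)) = -v j)
    (hu0 : ∀ i, |u i| ≤ u 0) (hv0 : ∀ i, |v i| ≤ (-1) ^ p * v p)
    (hu : ∑ i ∈ Finset.range (k + 1), u i * u i = 1)
    (hv : ∑ i ∈ Finset.range (k + 1), v i * v i = 1) :
    Real.arccos (Real.cos ((p : ℝ) * π / ((k : ℝ) + 1) + π / (2 * (k : ℝ) * ((k : ℝ) + 1)) *
        ((1 - (∑ i ∈ Finset.range (k + 1), v (p + i)) / v p)
          - (1 - (∑ i ∈ Finset.range (k + 1), u i) / u 0))))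
      ≤ Real.arccos (∑ i ∈ Finset.range (k + 1), u i * v i) + ((k : ℝ) - 1) * π / k := by
  have hk' : (3 : ℝ) ≤ k := by exact_mod_cast hk
  have hpi := Real.pi_pos
  have hd := sum_sq_sub_le_arccos_sq hu hv
  have hd0 := Real.arccos_nonneg (∑ i ∈ Finset.range (k + 1), u i * v i)
  rcases hp.eq_or_lt with rfl | hp'
  · have h0 : v (k + 1) = -v 0 := by simpa using hanti 0
    rw [hodd.add_one.neg_one_pow, one_mul, h0] at hv0
    have h1 := pi_div_le_arccos_of_opposite hk hu hv hu0 hv0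
    have h2 : π = π / k + ((k : ℝ) - 1) * π / k := by field_simp; ring
    have h3 := Real.arccos_le_pi (Real.cos (((k + 1 : ℕ) : ℝ) * π / ((k : ℝ) + 1)
      + π / (2 * (k : ℝ) * ((k : ℝ) + 1)) *
        ((1 - (∑ i ∈ Finset.range (k + 1), v (k + 1 + i)) / v (k + 1))
          - (1 - (∑ i ∈ Finset.range (k + 1), u i) / u 0))))
    linarith
  set d := Real.arccos (∑ i ∈ Finset.range (k + 1), u i * v i)
  set c := π / (2 * (k : ℝ) * ((k : ℝ) + 1)) with hc
  have hc0 : 0 < c := by positivity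
  have hMu := one_le_mul_sq_of_dominates hu hu0
  have hMv := one_le_mul_sq_of_dominates hv hv0
  have hune : u 0 ≠ 0 := fun h => by rw [h] at hMu; norm_num at hMu
  have hvne : v p ≠ 0 := fun h => by rw [h] at hMv; norm_num at hMv
  have hbu := abs_le.mp (abs_one_sub_window_div_le (k := k) hune
    fun i => (hu0 i).trans (le_abs_self _))
  have hbv := abs_le.mp (abs_one_sub_window_div_le (k := k) (w := fun i => v (p + i)) hvne
    fun i => (hv0 _).trans ((le_abs_self _).trans (by simp [abs_mul])))
  simp only [add_zero] at hbv
  have hck : c * (2 * k) = π / (k + 1) := by rw [hc]; field_simp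
  have hpk : (0 : ℝ) ≤ p := Nat.cast_nonneg p
  refine (arccos_cos_le_abs _).trans ?_
  have hpn : (p : ℝ) * π / (k + 1) = p * (c * (2 * k)) := by rw [hck]; ring
  have hkk : ((k : ℝ) - 1) * π / k = (k - 1) * (c * (2 * (k + 1))) := by
    rw [hc]; field_simp
  rw [hpn, hkk]
  set U := (∑ i ∈ Finset.range (k + 1), u i) / u 0
  set V := (∑ i ∈ Finset.range (k + 1), v (p + i)) / v p with hV
  have hlow : -(2 * (k : ℝ)) ≤ (1 - V) - (1 - U) := by linarith
  have hup : (1 - V) - (1 - U) ≤ 2 * (k : ℝ) := by linarith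
  have hlow' := mul_le_mul_of_nonneg_left hlow hc0.le
  have hup' := mul_le_mul_of_nonneg_left hup hc0.le
  have hcp : 0 ≤ c * p := by positivity
  have hck0 : 0 < c * k := by positivity
  rw [abs_le]
  rcases lt_or_ge (p + 1) k with h | h
  · have h' : (p : ℝ) + 2 ≤ k := by exact_mod_cast h
    have h1 := mul_le_mul_of_nonneg_left h' hck0.le
    have h2 : c * 3 ≤ c * k := mul_le_mul_of_nonneg_left hk' hc0.le
    have h3 : 0 ≤ c * k * p := by positivity
    have h4 : c * k * 3 ≤ c * k * k := mul_le_mul_of_nonneg_left hk' hck0.le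
    constructor <;> nlinarith
  · have h1' : (1 : ℝ) ≤ p := by exact_mod_cast (by omega : 1 ≤ p)
    have h1 : 0 ≤ c * k * (p - 1) := mul_nonneg hck0.le (by linarith)
    have h2 : 0 ≤ c * (k + 1) * (k - 1) := mul_nonneg (by positivity) (by linarith)
    refine ⟨by nlinarith, ?_⟩
    rcases (by omega : p + 1 = k ∨ p = k) with rfl | rfl
    · have hev : Even p := by simpa [Nat.odd_add_one] using hodd
      rw [hev.neg_one_pow, one_mul] at hv0
      have hmain := window_div_sub_le_of_even hanti hu0 hv0 hu hv hd0 hd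
      push_cast at *
      have hs := pi_div_mul_sqrt_add_two_le (q := p) (by linarith)
      rw [← hc] at hs
      have h3 := mul_le_mul_of_nonneg_left hmain hc0.le
      have h4 := mul_le_mul_of_nonneg_right hs hd0
      nlinarith
    · rw [hodd.neg_one_pow, neg_one_mul] at hv0
      have hmain := window_div_sub_le_of_odd (by omega) hanti hu0 hv0 hu hv hd0 hd
      have hs := pi_div_mul_sqrt_le hk'
      rw [← hc] at hs
      have h3 := mul_le_mul_of_nonneg_left hmain hc0.le
      have h4 := mul_le_mul_of_nonneg_right hs hd0
      nlinarith

lemma gSign_add (k m : ℕ) : gSign k (m + 1 + (k + 1)) = -gSign k (m + 1) := by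
  have h : m + 1 + (k + 1) - 1 = m + (k + 1) := by omega
  rw [gSign, gSign, h, Nat.add_mod_right, Nat.add_div_right _ (Nat.succ_pos k),
    Nat.add_sub_cancel, Nat.succ_eq_add_one, ← add_assoc, pow_succ, mul_neg_one]

lemma gIdx_add (k m : ℕ) : gIdx k (m + 1 + (k + 1)) = gIdx k (m + 1) := by
  have h : m + 1 + (k + 1) - 1 = m + (k + 1) := by omega
  simp [gIdx, h]

lemma neg_mem_Gcal_add {k m : ℕ} {x : Euc (k+1)} (hx : x ∈ Gcal k (m + 1)) :
    -x ∈ Gcal k (m + 1 + (k + 1)) := by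
  refine ⟨by simpa [usphere] using hx.1, fun j => ?_⟩
  rw [gSign_add, gIdx_add]
  simpa using hx.2 j

lemma fFun_neg_add (k m : ℕ) (x : Euc (k+1)) :
    fFun k (m + 1 + (k + 1)) (-x) = fFun k (m + 1) x + π := by
  have h : m + 1 + (k + 1) - 1 = m + (k + 1) := by omega
  have hk : ((k : ℝ) + 1) ≠ 0 := by positivity
  simp only [fFun, gIdx_add, h, Nat.add_mod_right, Nat.add_sub_cancel, PiLp.neg_apply, mul_neg,
    Finset.sum_neg_distrib, neg_div_neg_eq]
  push_cast
  field_simp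
  ring

lemma circleDist_comm (θ φ : ℝ) : circleDist θ φ = circleDist φ θ := by
  rw [circleDist, circleDist, ← Real.cos_neg, neg_sub]

lemma circleDist_add_two_pi (θ φ : ℝ) : circleDist (θ + π + π) φ = circleDist θ φ := by
  rw [circleDist, circleDist, ← Real.cos_add_two_pi (θ - φ)]
  ring_nf

lemma circleDist_add_pi (θ φ : ℝ) : circleDist θ (φ + π) = π - circleDist θ φ := by
  rw [circleDist, circleDist, ← Real.arccos_neg, ← Real.cos_sub_pi]
  ring_nf

lemma geoDist_comm {d : ℕ} (x y : Euc d) : geoDist x y = geoDist y x := by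
  rw [geoDist, geoDist, real_inner_comm]

lemma antiExt_ne_zero_of_mem_Gcal {k : ℕ} (hodd : Odd k) {r : ℕ} {x : Euc (k+1)}
    (hx : x ∈ Gcal k (r + 1)) : antiExt k x r ≠ 0 := fun h => by
  have h1 : ∀ i, antiExt k x i = 0 := fun i => by
    simpa [h] using abs_antiExt_le_of_mem_Gcal hodd hx i
  have h2 : @inner ℝ _ _ x x = (1 : ℝ) := hx.1
  rw [inner_eq_sum_antiExt] at h2
  simp [h1] at h2

lemma circleDist_le_of_le {k : ℕ} (hk : 3 ≤ k) (hodd : Odd k) {r p : ℕ} (hp : p ≤ k + 1)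
    {x y : Euc (k+1)} (hx : x ∈ Gcal k (r + 1)) (hy : y ∈ Gcal k (r + p + 1)) :
    circleDist (fFun k (r + 1) x) (fFun k (r + p + 1) y)
      ≤ geoDist x y + ((k : ℝ) - 1) * π / k := by
  have hsq : ((-1 : ℝ) ^ r) * (-1) ^ r = 1 := by rw [← mul_pow]; norm_num
  have hs0 : ((-1 : ℝ) ^ r) ≠ 0 := by positivity
  have hmul : ∀ z w : Euc (k+1), ∑ i ∈ Finset.range (k + 1),
      ((-1) ^ r * antiExt k z (r + i)) * ((-1) ^ r * antiExt k w (r + i)) = @inner ℝ _ _ z w := by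
    intro z w
    rw [← sum_window_antiExt_mul k r]
    exact Finset.sum_congr rfl fun i _ => by
      rw [mul_mul_mul_comm, hsq, one_mul]
  have key := arccos_cos_angle_le hk hodd (u := fun i => (-1) ^ r * antiExt k x (r + i))
    (v := fun i => (-1) ^ r * antiExt k y (r + i)) hp
    (fun j => by rw [← add_assoc, antiExt_add, mul_neg])
    (fun i => by
      simpa [abs_mul] using abs_antiExt_le_of_mem_Gcal hodd hx (r + i))
    (fun i => by
      have := abs_antiExt_le_of_mem_Gcal hodd hy (r + i)
      rw [pow_add] at this
      simpa [abs_mul, mul_assoc, mul_left_comm] using this)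
    ((hmul x x).trans hx.1) ((hmul y y).trans hy.1)
  rw [hmul] at key
  simp only [← Finset.mul_sum, mul_div_mul_left _ _ hs0, add_zero] at key
  rw [circleDist_comm, circleDist, geoDist,
    fFun_eq_antiExt r x (antiExt_ne_zero_of_mem_Gcal hodd hx),
    fFun_eq_antiExt (r + p) y (antiExt_ne_zero_of_mem_Gcal hodd hy)]
  refine le_trans (le_of_eq ?_) key
  congr 2
  simp only [add_assoc]
  push_cast
  ring

lemma circleDist_le_of_add {k : ℕ} (hk : 3 ≤ k) (hodd : Odd k) (p : ℕ) :
    ∀ (r : ℕ) (x y : Euc (k+1)), x ∈ Gcal k (r + 1) → y ∈ Gcal k (r + p + 1) →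
    circleDist (fFun k (r + 1) x) (fFun k (r + p + 1) y)
      ≤ geoDist x y + ((k : ℝ) - 1) * π / k := by
  induction p using Nat.strong_induction_on with
  | _ p ih =>
    intro r x y hx hy
    rcases le_or_gt p (k + 1) with hp | hp
    · exact circleDist_le_of_le hk hodd hp hx hy
    have e : r + 1 + (k + 1) = r + (k + 1) + 1 := by ring
    have hx1 := neg_mem_Gcal_add hx
    have f1 := fFun_neg_add k r x
    rw [e] at hx1 f1
    have e2 : r + (k + 1) + 1 + (k + 1) = r + 2 * (k + 1) + 1 := by ring
    have hx2 := neg_mem_Gcal_add hx1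
    have f2 := fFun_neg_add k (r + (k + 1)) (-x)
    rw [e2, neg_neg] at hx2 f2
    have hc : circleDist (fFun k (r + 2 * (k + 1) + 1) x) (fFun k (r + p + 1) y)
        = circleDist (fFun k (r + 1) x) (fFun k (r + p + 1) y) := by
      rw [f2, f1, circleDist_add_two_pi]
    rw [← hc]
    rcases le_total p (2 * (k + 1)) with h | h
    · obtain ⟨q, hq⟩ := Nat.exists_eq_add_of_le h
      have e3 : r + 2 * (k + 1) = r + p + q := by omega
      rw [e3] at hx2 ⊢
      rw [circleDist_comm, geoDist_comm]
      exact circleDist_le_of_le hk hodd (by omega) hy hx2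
    · obtain ⟨q, hq⟩ := Nat.exists_eq_add_of_le h
      have e3 : r + p = r + 2 * (k + 1) + q := by omega
      rw [e3] at hy ⊢
      exact ih q (by omega) _ x y hx2 hy

lemma circleDist_le {k : ℕ} (hk : 3 ≤ k) (hodd : Odd k) {m m' : ℕ} (hm : 1 ≤ m) (hm' : 1 ≤ m')
    {x y : Euc (k+1)} (hx : x ∈ Gcal k m) (hy : y ∈ Gcal k m') :
    circleDist (fFun k m x) (fFun k m' y) ≤ geoDist x y + ((k : ℝ) - 1) * π / k := by
  obtain ⟨r, rfl⟩ := Nat.exists_eq_add_of_le' hm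
  obtain ⟨s, rfl⟩ := Nat.exists_eq_add_of_le' hm'
  rcases le_total r s with h | h
  · obtain ⟨p, rfl⟩ := Nat.exists_eq_add_of_le h
    exact circleDist_le_of_add hk hodd p r x y hx hy
  · obtain ⟨p, rfl⟩ := Nat.exists_eq_add_of_le h
    rw [circleDist_comm, geoDist_comm]
    exact circleDist_le_of_add hk hodd p s y x hy hx

lemma abs_geoDist_sub_circleDist_le {k : ℕ} (hk : 3 ≤ k) (hodd : Odd k) {m m' : ℕ}
    (hm : 1 ≤ m) (hm' : 1 ≤ m') {x y : Euc (k+1)} (hx : x ∈ Gcal k m) (hy : y ∈ Gcal k m') :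
    |geoDist x y - circleDist (fFun k m x) (fFun k m' y)| ≤ ((k : ℝ) - 1) * π / k := by
  have h1 := circleDist_le hk hodd hm hm' hx hy
  obtain ⟨s, rfl⟩ := Nat.exists_eq_add_of_le' hm'
  have h2 := circleDist_le hk hodd hm (by omega) hx (neg_mem_Gcal_add hy)
  rw [fFun_neg_add, circleDist_add_pi, geoDist_neg_right] at h2
  exact abs_le.mpr ⟨by linarith, by linarith⟩

/-- The unit vector with all coordinates equal. -/
def diagVec (k : ℕ) : Euc (k+1) := WithLp.toLp 2 fun _ => (Real.sqrt ((k : ℝ) + 1))⁻¹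

lemma diagVec_apply (k : ℕ) (j : Fin (k+1)) : diagVec k j = (Real.sqrt ((k : ℝ) + 1))⁻¹ := rfl

lemma diagVec_mem_usphere (k : ℕ) : diagVec k ∈ usphere k := by
  have hk : (0 : ℝ) < (k : ℝ) + 1 := by positivity
  have h := Real.mul_self_sqrt hk.le
  simp only [usphere, Set.mem_ofPred_eq, PiLp.inner_apply, diagVec_apply]
  simp only [RCLike.inner_apply, conj_trivial, Finset.sum_const, Finset.card_univ,
    Fintype.card_fin, nsmul_eq_mul]
  rw [← mul_inv, h]
  push_cast
  field_simp

lemma diagVec_mem_Gcal {k r : ℕ} (hr : Even r) (hrk : r < k + 1) :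
    diagVec k ∈ Gcal k (r + 1) := by
  refine ⟨diagVec_mem_usphere k, fun j => ?_⟩
  simp only [gSign, Nat.add_sub_cancel, Nat.mod_eq_of_lt hrk, Nat.div_eq_of_lt hrk, add_zero,
    hr.neg_one_pow, one_mul, diagVec_apply]
  exact (abs_of_nonneg (by positivity)).le

lemma fFun_diagVec {k r : ℕ} (hk : 1 ≤ k) (hrk : r < k + 1) :
    fFun k (r + 1) (diagVec k) = (r : ℝ) * π / k - π / (2 * (k + 1)) := by
  have hk' : (0 : ℝ) < k := by exact_mod_cast hk
  have hs : (Real.sqrt ((k : ℝ) + 1))⁻¹ ≠ 0 := by positivity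
  have hext : ∀ i < k + 1, antiExt k (diagVec k) i = (Real.sqrt ((k : ℝ) + 1))⁻¹ := fun i hi => by
    rw [antiExt_of_lt _ hi, diagVec_apply]
  rw [fFun_eq_antiExt r _ (by rwa [hext r hrk]), sum_window_antiperiodic (antiExt_add k _),
    hext r hrk, Finset.sum_congr rfl fun i hi => hext i (Finset.mem_range.mp hi),
    Finset.sum_congr rfl fun i hi => hext i ((Finset.mem_range.mp hi).trans hrk)]
  simp only [Finset.sum_const, Finset.card_range, nsmul_eq_mul, ← mul_assoc, ← sub_mul,
    mul_div_cancel_right₀ _ hs]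
  push_cast
  field_simp
  ring

/-- Let k ≥ 3 be odd. The distortion of the correspondence
ℛ_k = {(x, f_m(x)) : 1 ≤ m ≤ 2k+2, x ∈ 𝒢_m} ⊆ S^k × S¹ equals (k−1)π/k,
where the angle f_m(x) is identified with the point (cos f_m(x), sin f_m(x)) ∈ S¹. -/
theorem distortion_Rk (k : ℕ) (hk : 3 ≤ k) (hodd : Odd k) :
    sSup {t : ℝ | ∃ m, 1 ≤ m ∧ m ≤ 2*k+2 ∧ ∃ x ∈ Gcal k m,
        ∃ m', 1 ≤ m' ∧ m' ≤ 2*k+2 ∧ ∃ x' ∈ Gcal k m',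
        t = |geoDist x x' - circleDist (fFun k m x) (fFun k m' x')|}
      = ((k : ℝ) - 1) * π / k := by
  have hk0 : (3 : ℝ) ≤ k := by exact_mod_cast hk
  have hpi := Real.pi_pos
  refine IsGreatest.csSup_eq ⟨?_, ?_⟩
  · obtain ⟨q, rfl⟩ := Nat.exists_eq_add_of_le' (by omega : 1 ≤ k)
    have hev : Even q := by simpa [Nat.odd_add_one] using hodd
    refine ⟨0 + 1, le_rfl, by omega, _, diagVec_mem_Gcal Even.zero (by omega), q + 1, by omega,
      by omega, _, diagVec_mem_Gcal hev (by omega), ?_⟩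
    rw [fFun_diagVec (by omega) (by omega), fFun_diagVec (by omega) (by omega), circleDist_comm]
    have h1 : @inner ℝ _ _ (diagVec (q + 1)) (diagVec (q + 1)) = (1 : ℝ) := diagVec_mem_usphere _
    push_cast at hk0 ⊢
    have h2 : (q : ℝ) * π / (q + 1) ≤ π := by
      rw [div_le_iff₀ (by positivity)]; nlinarith
    rw [geoDist, h1, Real.arccos_one, zero_sub, abs_neg, circleDist, zero_mul, zero_div,
      sub_sub_sub_cancel_right, sub_zero, Real.arccos_cos (by positivity) h2,
      abs_of_nonneg (by positivity), add_sub_cancel_right]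
  · rintro t ⟨m, hm, -, x, hx, m', hm', -, y, hy, rfl⟩
    exact abs_geoDist_sub_circleDist_le hk hodd hm hm' hx hy
end
end
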